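/- arXiv:2303.17052 — 15 statements merged into one kernel-verified Lean document; each statement's English description precedes it below -/
import Mathlib

section
/- Let ω ∈ ℝ and let {U_n}_{n∈ℤ} ⊂ ℂ satisfy (1+|U_n|²)(U_{n+1}+U_{n-1}) = 2ω U_n for all n ∈ ℤ. Then the quantity F_0(n) := i(U_n conj(U_{n-1}) − conj(U_n) U_{n-1}) is real-valued and independent of n, i.e. F_0(n+1) = F_0(n) for all n ∈ ℤ. -/
open Complex ComplexConjugate

/-- For a solution of the standing-wave difference equation
`(1+|Uₙ|²)(Uₙ₊₁+Uₙ₋₁) = 2ω Uₙ` of the Ablowitz–Ladik equation, the quantity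
`F₀(n) = i(Uₙ conj(Uₙ₋₁) − conj(Uₙ) Uₙ₋₁)` is real-valued and independent of `n`. -/
theorem standing_wave_F0_conserved (ω : ℝ) (U : ℤ → ℂ)
    (hU : ∀ n : ℤ, (1 + (Complex.normSq (U n) : ℂ)) * (U (n + 1) + U (n - 1))
      = 2 * (ω : ℂ) * U n)
    (F₀ : ℤ → ℂ)
    (hF₀ : ∀ n : ℤ, F₀ n = Complex.I * (U n * conj (U (n - 1)) - conj (U n) * U (n - 1))) :
    ∀ n : ℤ, (F₀ n).im = 0 ∧ F₀ (n + 1) = F₀ n := by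
  intro n
  refine ⟨by rw [hF₀]; simp, ?_⟩
  have hpos : (1 + (Complex.normSq (U n) : ℂ)) ≠ 0 := by
    exact_mod_cast (add_pos_of_pos_of_nonneg one_pos (Complex.normSq_nonneg (U n))).ne'
  have hconj : (1 + (Complex.normSq (U n) : ℂ)) * (conj (U (n + 1)) + conj (U (n - 1)))
      = 2 * (ω : ℂ) * conj (U n) := by
    simpa [Complex.conj_ofNat] using congrArg conj (hU n)
  rw [hF₀, hF₀, add_sub_cancel_right]
  apply mul_left_cancel₀ hpos
  linear_combination Complex.I * conj (U n) * hU n - Complex.I * U n * hconj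
end

section
/- Let ω ∈ ℝ and let {U_n}_{n∈ℤ} ⊂ ℂ satisfy (1+|U_n|²)(U_{n+1}+U_{n-1}) = 2ω U_n for all n ∈ ℤ. Then the quantity F_1(n) := ω(U_n conj(U_{n-1}) + conj(U_n) U_{n-1}) − |U_n|² − |U_{n-1}|² − |U_n|² |U_{n-1}|² is real-valued and independent of n, i.e. F_1(n+1) = F_1(n) for all n ∈ ℤ. -/
open Complex ComplexConjugate

/-- For a solution of the standing-wave difference equation
`(1+|Uₙ|²)(Uₙ₊₁+Uₙ₋₁) = 2ω Uₙ` of the Ablowitz–Ladik equation, the quantity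
`F₁(n) = ω(Uₙ conj(Uₙ₋₁) + conj(Uₙ) Uₙ₋₁) − |Uₙ|² − |Uₙ₋₁|² − |Uₙ|²|Uₙ₋₁|²`
is real-valued and independent of `n`. -/
theorem standing_wave_F1_conserved (ω : ℝ) (U : ℤ → ℂ)
    (hU : ∀ n : ℤ, (1 + (Complex.normSq (U n) : ℂ)) * (U (n + 1) + U (n - 1))
      = 2 * (ω : ℂ) * U n)
    (F₁ : ℤ → ℂ)
    (hF₁ : ∀ n : ℤ, F₁ n = (ω : ℂ) * (U n * conj (U (n - 1)) + conj (U n) * U (n - 1))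
      - (Complex.normSq (U n) : ℂ) - (Complex.normSq (U (n - 1)) : ℂ)
      - (Complex.normSq (U n) : ℂ) * (Complex.normSq (U (n - 1)) : ℂ)) :
    ∀ n : ℤ, (F₁ n).im = 0 ∧ F₁ (n + 1) = F₁ n := by
  intro n
  refine ⟨?_, ?_⟩
  · rw [← conj_eq_iff_im, hF₁]
    simp only [map_sub, map_mul, map_add, conj_ofReal, conj_conj]
    ring
  · have h := hU n
    have h' := congrArg conj h
    rw [hF₁, hF₁, add_sub_cancel_right]
    simp only [map_mul, map_add, map_one, map_ofNat, conj_ofReal, conj_conj,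
      normSq_eq_conj_mul_self] at h h' ⊢
    linear_combination (-1 / 2 : ℂ) * (conj (U (n + 1)) - conj (U (n - 1))) * h
      - (1 / 2 : ℂ) * (U (n + 1) - U (n - 1)) * h'
end

section
/- Let u : ℝ → (ℤ → ℂ) be differentiable in t. Then u satisfies the Ablowitz–Ladik equation i u̇_n + (1+|u_n|²)(u_{n+1}+u_{n-1}) = 0 for all n ∈ ℤ and t ∈ ℝ if and only if, for every λ ∈ ℂ\{0}, every n ∈ ℤ and every t ∈ ℝ, the zero-curvature equation d/dt U(u_n(t),λ) = V(u_{n+1}(t), u_n(t), λ) U(u_n(t),λ) − U(u_n(t),λ) V(u_n(t), u_{n-1}(t), λ) holds, where U(u,λ) := (1+|u|²)^{-1/2}·[[λ, u],[−conj(u), λ^{-1}]] and V(a,b,λ) := i·[[½(λ²+λ^{-2}+a·conj(b)+conj(a)·b), λa − λ^{-1}b],[−λ·conj(b) + λ^{-1}·conj(a), −½(λ²+λ^{-2}+a·conj(b)+conj(a)·b)]]. -/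
open Complex ComplexConjugate Matrix

/-- The spatial Lax matrix `U(u,λ) = (1+|u|²)^{-1/2} [[λ, u], [−conj u, λ⁻¹]]`
of the non-standard Lax pair of the Ablowitz–Ladik equation. -/
noncomputable def ALaxU (u lam : ℂ) : Matrix (Fin 2) (Fin 2) ℂ :=
  ((Real.sqrt (1 + Complex.normSq u) : ℂ))⁻¹ •
    !![lam, u; -conj u, lam⁻¹]

/-- The temporal Lax matrix `V(a,b,λ)` of the non-standard Lax pair of the
Ablowitz–Ladik equation, where `a` plays the role of `uₙ` and `b` of `uₙ₋₁`. -/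
noncomputable def ALaxV (a b lam : ℂ) : Matrix (Fin 2) (Fin 2) ℂ :=
  Complex.I •
    !![(1 / 2 : ℂ) * (lam ^ 2 + lam⁻¹ ^ 2 + a * conj b + conj a * b),
        lam * a - lam⁻¹ * b;
      -lam * conj b + lam⁻¹ * conj a,
        -((1 / 2 : ℂ) * (lam ^ 2 + lam⁻¹ ^ 2 + a * conj b + conj a * b))]

/-- The derivative of the normalising factor `(1+|f|²)^{-1/2}`, written through the factor itself. -/
theorem HasDerivAt.inv_sqrt_one_add_normSq {f : ℝ → ℂ} {f' : ℂ} {t : ℝ}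
    (hf : HasDerivAt f f' t) :
    HasDerivAt (fun s => ((Real.sqrt (1 + normSq (f s)) : ℂ))⁻¹)
      (-(1 / 2) * ((Real.sqrt (1 + normSq (f t)) : ℂ))⁻¹ ^ 3
        * (f' * conj (f t) + f t * conj f')) t := by
  have hpos : 0 < 1 + normSq (f t) := by linarith [normSq_nonneg (f t)]
  have hre : HasDerivAt (fun s => (f s).re) f'.re t :=
    reCLM.hasFDerivAt.comp_hasDerivAt t hf
  have him : HasDerivAt (fun s => (f s).im) f'.im t :=
    imCLM.hasFDerivAt.comp_hasDerivAt t hf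
  have hN : HasDerivAt (fun s => 1 + normSq (f s))
      (f'.re * (f t).re + (f t).re * f'.re + (f'.im * (f t).im + (f t).im * f'.im)) t := by
    simpa only [normSq_apply] using ((hre.fun_mul hre).fun_add (him.fun_mul him)).const_add 1
  have hsqrt : (Real.sqrt (1 + normSq (f t)) : ℂ) ≠ 0 :=
    ofReal_ne_zero.mpr (Real.sqrt_pos.mpr hpos).ne'
  have hsum : f' * conj (f t) + f t * conj f'
      = ((f'.re * (f t).re + (f t).re * f'.re
          + (f'.im * (f t).im + (f t).im * f'.im) : ℝ) : ℂ) := by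
    apply Complex.ext <;> simp <;> ring
  have h := ((hN.sqrt hpos.ne').ofReal_comp).fun_inv hsqrt
  refine h.congr_deriv ?_
  rw [hsum, ofReal_div, ofReal_mul, ofReal_ofNat]
  field_simp

/-- A differentiable `u : ℝ → (ℤ → ℂ)` satisfies the Ablowitz–Ladik
equation `i u̇ₙ + (1+|uₙ|²)(uₙ₊₁+uₙ₋₁) = 0` if and only if the zero-curvature equation
`d/dt U(uₙ(t),λ) = V(uₙ₊₁,uₙ,λ) U(uₙ,λ) − U(uₙ,λ) V(uₙ,uₙ₋₁,λ)` holds for every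
`λ ∈ ℂ \ {0}`, every `n ∈ ℤ` and every `t ∈ ℝ`. -/
theorem AL_iff_zero_curvature (u : ℝ → ℤ → ℂ)
    (hu : ∀ n : ℤ, Differentiable ℝ fun t => u t n) :
    (∀ (n : ℤ) (t : ℝ),
        Complex.I * deriv (fun s => u s n) t
          + (1 + (Complex.normSq (u t n) : ℂ)) * (u t (n + 1) + u t (n - 1)) = 0)
    ↔ (∀ (lam : ℂ), lam ≠ 0 → ∀ (n : ℤ) (t : ℝ) (i j : Fin 2),
        deriv (fun s => ALaxU (u s n) lam i j) t
          = (ALaxV (u t (n + 1)) (u t n) lam * ALaxU (u t n) lam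
              - ALaxU (u t n) lam * ALaxV (u t n) (u t (n - 1)) lam) i j) := by
  have key : ∀ (n : ℤ) (t : ℝ), ∃ c : ℂ, c ≠ 0 ∧
      c ^ 2 * (1 + u t n * conj (u t n)) = 1 ∧
      ALaxU (u t n) = (fun lam => c • !![lam, u t n; -conj (u t n), lam⁻¹]) ∧
      ∀ (lam : ℂ) (i j : Fin 2), deriv (fun s => ALaxU (u s n) lam i j) t
        = ((-(1 / 2) * c ^ 3 * (deriv (fun s => u s n) t * conj (u t n)
              + u t n * conj (deriv (fun s => u s n) t)))
            • !![lam, u t n; -conj (u t n), lam⁻¹]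
          + c • !![0, deriv (fun s => u s n) t;
              -conj (deriv (fun s => u s n) t), 0]) i j := by
    intro n t
    have hpos : 0 < 1 + normSq (u t n) := by linarith [normSq_nonneg (u t n)]
    have hsqrt : (Real.sqrt (1 + normSq (u t n)) : ℂ) ≠ 0 :=
      ofReal_ne_zero.mpr (Real.sqrt_pos.mpr hpos).ne'
    refine ⟨((Real.sqrt (1 + normSq (u t n)) : ℂ))⁻¹, inv_ne_zero hsqrt, ?_, rfl, ?_⟩
    · rw [mul_conj, inv_pow, ← ofReal_pow, Real.sq_sqrt hpos.le, ofReal_add, ofReal_one]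
      refine inv_mul_cancel₀ ?_
      exact_mod_cast hpos.ne'
    · intro lam i j
      have hf : HasDerivAt (fun s => u s n) (deriv (fun s => u s n) t) t :=
        (hu n t).hasDerivAt
      have hc := hf.inv_sqrt_one_add_normSq
      have hconj : HasDerivAt (fun s => conj (u s n)) (conj (deriv (fun s => u s n) t)) t :=
        conjCLE.toContinuousLinearMap.hasFDerivAt.comp_hasDerivAt t hf
      fin_cases i <;> fin_cases j
      · simpa [ALaxU] using (hc.mul_const lam).deriv
      · simpa [ALaxU] using (hc.fun_mul hf).deriv
      · simpa [ALaxU] using (hc.fun_mul hconj.fun_neg).deriv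
      · simpa [ALaxU] using (hc.mul_const lam⁻¹).deriv
  constructor
  · intro h lam hlam n t i j
    obtain ⟨c, -, hcc, hU, hd⟩ := key n t
    have hAL := h n t
    rw [hd, hU]
    rw [← mul_conj] at hAL
    generalize deriv (fun s => u s n) t = v at *
    have hv : v = I * ((1 + u t n * conj (u t n)) * (u t (n + 1) + u t (n - 1))) := by
      linear_combination (-I) * hAL + v * I_sq
    have hv' : conj v = -I * ((1 + u t n * conj (u t n))
        * (conj (u t (n + 1)) + conj (u t (n - 1)))) := by
      rw [hv]; simp only [map_mul, map_add, map_one, conj_I, conj_conj]; ring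
    rw [hv', hv]
    have hl : lam * lam⁻¹ = 1 := mul_inv_cancel₀ hlam
    fin_cases i <;> fin_cases j <;> simp [ALaxV]
    · linear_combination (-(1 / 2) * c * I
        * (conj (u t n) * (u t (n + 1) + u t (n - 1))
          - u t n * (conj (u t (n + 1)) + conj (u t (n - 1)))) * lam) * hcc
    · linear_combination (-(1 / 2) * c * I
        * (conj (u t n) * (u t (n + 1) + u t (n - 1))
          - u t n * (conj (u t (n + 1)) + conj (u t (n - 1)))) * u t n) * hcc
        - I * c * (u t (n + 1) + u t (n - 1)) * hl
    · linear_combination ((1 / 2) * c * I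
        * (conj (u t n) * (u t (n + 1) + u t (n - 1))
          - u t n * (conj (u t (n + 1)) + conj (u t (n - 1)))) * conj (u t n)) * hcc
        - I * c * (conj (u t (n + 1)) + conj (u t (n - 1))) * hl
    · linear_combination (-(1 / 2) * c * I
        * (conj (u t n) * (u t (n + 1) + u t (n - 1))
          - u t n * (conj (u t (n + 1)) + conj (u t (n - 1)))) * lam⁻¹) * hcc
  · intro h n t
    obtain ⟨c, hc, hcc, hU, hd⟩ := key n t
    have h00 := h 1 one_ne_zero n t 0 0
    have h01 := h 1 one_ne_zero n t 0 1
    rw [hd, hU] at h00 h01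
    rw [← mul_conj]
    simp [ALaxV] at h00 h01
    refine mul_left_cancel₀ hc ?_
    linear_combination I * h01 - I * u t n * h00
      + (c * (u t (n + 1) + u t (n - 1)) * (1 + u t n * conj (u t n))) * I_sq
end

section
/- Let u : ℝ → (ℤ → ℂ) be differentiable in t. Then u satisfies the Ablowitz–Ladik equation i u̇_n + (1+|u_n|²)(u_{n+1}+u_{n-1}) = 0 for all n ∈ ℤ and t ∈ ℝ if and only if, for every λ ∈ ℂ\{0}, every n ∈ ℤ and every t ∈ ℝ, the zero-curvature equation d/dt U₀(u_n(t),λ) = V₀(u_{n+1}(t), u_n(t), λ) U₀(u_n(t),λ) − U₀(u_n(t),λ) V₀(u_n(t), u_{n-1}(t), λ) holds, where U₀(u,λ) := [[λ, u],[−conj(u), λ^{-1}]] and V₀(a,b,λ) := i·[[½(λ²+λ^{-2}) + a·conj(b), λa − λ^{-1}b],[−λ·conj(b) + λ^{-1}·conj(a), −½(λ²+λ^{-2}) − conj(a)·b]]. -/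
open Complex ComplexConjugate Matrix

/-- The spatial matrix `U₀(u,λ) = [[λ, u], [−conj u, λ⁻¹]]` of the simpler
(standard) Lax pair of the Ablowitz–Ladik equation. -/
noncomputable def ALaxU₀ (u lam : ℂ) : Matrix (Fin 2) (Fin 2) ℂ :=
  !![lam, u; -conj u, lam⁻¹]

/-- The temporal matrix `V₀(a,b,λ)` of the simpler (standard) Lax pair of the
Ablowitz–Ladik equation, where `a` plays the role of `uₙ` and `b` of `uₙ₋₁`. -/
noncomputable def ALaxV₀ (a b lam : ℂ) : Matrix (Fin 2) (Fin 2) ℂ :=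
  Complex.I •
    !![(1 / 2 : ℂ) * (lam ^ 2 + lam⁻¹ ^ 2) + a * conj b,
        lam * a - lam⁻¹ * b;
      -lam * conj b + lam⁻¹ * conj a,
        -((1 / 2 : ℂ) * (lam ^ 2 + lam⁻¹ ^ 2)) - conj a * b]

/-- The commutator-type expression of the zero-curvature equation is off-diagonal and independent
of the spectral parameter. -/
theorem ALaxV₀_mul_ALaxU₀_sub (a u b lam : ℂ) (hlam : lam ≠ 0) :
    ALaxV₀ a u lam * ALaxU₀ u lam - ALaxU₀ u lam * ALaxV₀ u b lam
      = !![0, Complex.I * ((1 + (Complex.normSq u : ℂ)) * (a + b));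
          -conj (Complex.I * ((1 + (Complex.normSq u : ℂ)) * (a + b))), 0] := by
  ext i j
  fin_cases i <;> fin_cases j <;>
    simp [ALaxU₀, ALaxV₀, Complex.normSq_eq_conj_mul_self] <;>
    field_simp <;> ring

theorem I_mul_add_eq_zero_iff (d f : ℂ) :
    Complex.I * d + f = 0 ↔ d = Complex.I * f := by
  constructor <;> intro h
  · linear_combination (-Complex.I) * h + d * Complex.I_mul_I
  · linear_combination Complex.I * h + f * Complex.I_mul_I

/-- A differentiable `u : ℝ → (ℤ → ℂ)` satisfies the Ablowitz–Ladik
equation `i u̇ₙ + (1+|uₙ|²)(uₙ₊₁+uₙ₋₁) = 0` if and only if the zero-curvature equation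
`d/dt U₀(uₙ(t),λ) = V₀(uₙ₊₁,uₙ,λ) U₀(uₙ,λ) − U₀(uₙ,λ) V₀(uₙ,uₙ₋₁,λ)` holds for every
`λ ∈ ℂ \ {0}`, every `n ∈ ℤ` and every `t ∈ ℝ`. -/
theorem AL_iff_zero_curvature_standard (u : ℝ → ℤ → ℂ)
    (hu : ∀ n : ℤ, Differentiable ℝ fun t => u t n) :
    (∀ (n : ℤ) (t : ℝ),
        Complex.I * deriv (fun s => u s n) t
          + (1 + (Complex.normSq (u t n) : ℂ)) * (u t (n + 1) + u t (n - 1)) = 0)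
    ↔ (∀ (lam : ℂ), lam ≠ 0 → ∀ (n : ℤ) (t : ℝ) (i j : Fin 2),
        deriv (fun s => ALaxU₀ (u s n) lam i j) t
          = (ALaxV₀ (u t (n + 1)) (u t n) lam * ALaxU₀ (u t n) lam
              - ALaxU₀ (u t n) lam * ALaxV₀ (u t n) (u t (n - 1)) lam) i j) := by
  constructor
  · intro h lam hlam n t i j
    have hd : HasDerivAt (fun s => u s n) (Complex.I * ((1 + (Complex.normSq (u t n) : ℂ))
        * (u t (n + 1) + u t (n - 1)))) t := by
      rw [← (I_mul_add_eq_zero_iff _ _).1 (h n t)]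
      exact (hu n t).hasDerivAt
    rw [ALaxV₀_mul_ALaxU₀_sub _ _ _ _ hlam]
    fin_cases i <;> fin_cases j
    · exact deriv_const t lam
    · exact hd.deriv
    · exact hd.star.neg.deriv
    · exact deriv_const t lam⁻¹
  · intro h n t
    have h01 := h 1 one_ne_zero n t 0 1
    rw [ALaxV₀_mul_ALaxU₀_sub _ _ _ _ one_ne_zero] at h01
    exact (I_mul_add_eq_zero_iff _ _).2 h01
end

section
/- Let ω ∈ ℝ, let {U_n}_{n∈ℤ} ⊂ ℂ satisfy (1+|U_n|²)(U_{n+1}+U_{n-1}) = 2ω U_n for all n, and let λ ∈ ℂ\{0}. Suppose (P_n(t), Q_n(t)), n ∈ ℤ, is a differentiable-in-t solution of the separated Lax system. Then v_n(t) := λ P_n(t)² − conj(λ)^{-1} conj(Q_n(t))² + U_n (P_n(t)Q_n(t) + conj(P_n(t)) conj(Q_n(t))) satisfies the linearized Ablowitz–Ladik equation i v̇_n − 2ω v_n + (1+|U_n|²)(v_{n+1}+v_{n-1}) + (U_{n+1}+U_{n-1})(U_n conj(v_n) + conj(U_n) v_n) = 0 for all n ∈ ℤ and t ∈ ℝ.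 -/
open Complex ComplexConjugate

/-- `Wₙ = ½(λ² + λ⁻² + Uₙ conj(Uₙ₋₁) + conj(Uₙ) Uₙ₋₁)`, with `a` in the role of `Uₙ`
and `b` in the role of `Uₙ₋₁`. -/
noncomputable def ALW (a b lam : ℂ) : ℂ :=
  (1 / 2 : ℂ) * (lam ^ 2 + lam⁻¹ ^ 2 + a * conj b + conj a * b)

lemma one_add_normSq_mul_inv_sqrt_sq (a : ℂ) :
    (1 + (normSq a : ℂ)) * ((Real.sqrt (1 + normSq a) : ℂ))⁻¹ ^ 2 = 1 := by
  have hpos : 0 < 1 + normSq a := by linarith [normSq_nonneg a]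
  have h : ((Real.sqrt (1 + normSq a) : ℂ)) ^ 2 = 1 + (normSq a : ℂ) := by
    exact_mod_cast Real.sq_sqrt hpos.le
  have h0 : (1 + (normSq a : ℂ)) ≠ 0 := by exact_mod_cast hpos.ne'
  rw [inv_pow, h, mul_inv_cancel₀ h0]

/-- The forward shift of the squared eigenfunction, multiplied by `1 + |Uₙ|²`. Here `a`, `c`
stand for `Uₙ`, `Uₙ₊₁`. -/
lemma one_add_normSq_mul_sqEigenfunction_succ (a c lam p q p' q' : ℂ)
    (hp : p' = ((Real.sqrt (1 + normSq a) : ℂ))⁻¹ * (lam * p + a * q))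
    (hq : q' = ((Real.sqrt (1 + normSq a) : ℂ))⁻¹ * (-conj a * p + lam⁻¹ * q)) :
    (1 + (normSq a : ℂ)) * (lam * p' ^ 2 - (conj lam)⁻¹ * conj q' ^ 2
        + c * (p' * q' + conj p' * conj q'))
      = lam * (lam * p + a * q) ^ 2
        - (conj lam)⁻¹ * (-a * conj p + (conj lam)⁻¹ * conj q) ^ 2
        + c * ((lam * p + a * q) * (-conj a * p + lam⁻¹ * q)
          + (conj lam * conj p + conj a * conj q) * (-a * conj p + (conj lam)⁻¹ * conj q)) := by
  have hs := one_add_normSq_mul_inv_sqrt_sq a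
  rw [hp, hq]
  simp only [map_mul, map_add, map_neg, map_inv₀, conj_ofReal, conj_conj]
  linear_combination (lam * (lam * p + a * q) ^ 2
        - (conj lam)⁻¹ * (-a * conj p + (conj lam)⁻¹ * conj q) ^ 2
        + c * ((lam * p + a * q) * (-conj a * p + lam⁻¹ * q)
          + (conj lam * conj p + conj a * conj q)
            * (-a * conj p + (conj lam)⁻¹ * conj q))) * hs

/-- The backward shift of the squared eigenfunction, expressed through the current eigenfunction
`(p', q')`. Here `b` stands for `Uₙ₋₁`. -/
lemma sqEigenfunction_pred (b lam p q p' q' : ℂ) (hlam : lam ≠ 0)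
    (hp : p' = ((Real.sqrt (1 + normSq b) : ℂ))⁻¹ * (lam * p + b * q))
    (hq : q' = ((Real.sqrt (1 + normSq b) : ℂ))⁻¹ * (-conj b * p + lam⁻¹ * q)) :
    lam * p ^ 2 - (conj lam)⁻¹ * conj q ^ 2 + b * (p * q + conj p * conj q)
      = lam⁻¹ * p' ^ 2 - conj lam * conj q' ^ 2 - b * (p' * q' + conj p' * conj q') := by
  have hs := one_add_normSq_mul_inv_sqrt_sq b
  rw [← mul_conj] at hs
  have hlam' : conj lam ≠ 0 := (map_ne_zero _).2 hlam
  rw [hp, hq]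
  simp only [map_mul, map_add, map_neg, map_inv₀, conj_ofReal, conj_conj]
  generalize ((Real.sqrt (1 + normSq b) : ℂ))⁻¹ = r at hs
  linear_combination (norm := (field_simp; ring))
    (-(lam * p ^ 2 - (conj lam)⁻¹ * conj q ^ 2 + b * (p * q + conj p * conj q))) * hs

/-- squared eigenfunction relation, Lemma 2 of the paper.
If `(Pₙ(t), Qₙ(t))` solves the separated Lax system associated with a standing wave
`{Uₙ}` of the Ablowitz–Ladik equation, then
`vₙ = λPₙ² − conj(λ)⁻¹ conj(Qₙ)² + Uₙ(PₙQₙ + conj(Pₙ)conj(Qₙ))`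
solves the linearized Ablowitz–Ladik equation. -/
theorem squared_eigenfunctions_solve_linearized_AL
    (ω : ℝ) (U : ℤ → ℂ)
    (hU : ∀ n : ℤ, (1 + (Complex.normSq (U n) : ℂ)) * (U (n + 1) + U (n - 1))
      = 2 * (ω : ℂ) * U n)
    (lam : ℂ) (hlam : lam ≠ 0)
    (P Q : ℤ → ℝ → ℂ)
    (hspace : ∀ (n : ℤ) (t : ℝ),
      P (n + 1) t = ((Real.sqrt (1 + Complex.normSq (U n)) : ℂ))⁻¹
          * (lam * P n t + U n * Q n t)
      ∧ Q (n + 1) t = ((Real.sqrt (1 + Complex.normSq (U n)) : ℂ))⁻¹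
          * (-conj (U n) * P n t + lam⁻¹ * Q n t))
    (htime : ∀ (n : ℤ) (t : ℝ),
      HasDerivAt (fun s => P n s)
        (Complex.I * ((ALW (U n) (U (n - 1)) lam - (ω : ℂ)) * P n t
          + (lam * U n - lam⁻¹ * U (n - 1)) * Q n t)) t
      ∧ HasDerivAt (fun s => Q n s)
        (Complex.I * ((-lam * conj (U (n - 1)) + lam⁻¹ * conj (U n)) * P n t
          + ((ω : ℂ) - ALW (U n) (U (n - 1)) lam) * Q n t)) t)
    (v : ℤ → ℝ → ℂ)
    (hv : ∀ (n : ℤ) (t : ℝ),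
      v n t = lam * (P n t) ^ 2 - (conj lam)⁻¹ * (conj (Q n t)) ^ 2
        + U n * (P n t * Q n t + conj (P n t) * conj (Q n t))) :
    ∀ (n : ℤ) (t : ℝ),
      Complex.I * deriv (fun s => v n s) t - 2 * (ω : ℂ) * v n t
        + (1 + (Complex.normSq (U n) : ℂ)) * (v (n + 1) t + v (n - 1) t)
        + (U (n + 1) + U (n - 1)) * (U n * conj (v n t) + conj (U n) * v n t) = 0 := by
  intro n t
  obtain ⟨hP, hQ⟩ := htime n t
  have hderiv := (((hP.pow 2).const_mul lam).sub ((hQ.star.pow 2).const_mul (conj lam)⁻¹)).add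
    (((hP.mul hQ).add (hP.star.mul hQ.star)).const_mul (U n))
  have hvd : deriv (fun s => v n s) t = _ :=
    (hderiv.congr_of_eventuallyEq (Filter.Eventually.of_forall fun s => hv n s)).deriv
  have hsucc := one_add_normSq_mul_sqEigenfunction_succ (U n) (U (n + 1)) lam _ _ _ _
    (hspace n t).1 (hspace n t).2
  have hsp := hspace (n - 1) t
  rw [sub_add_cancel] at hsp
  have hpred := sqEigenfunction_pred (U (n - 1)) lam _ _ _ _ hlam hsp.1 hsp.2
  rw [← hv] at hsucc hpred
  have hlam' : conj lam ≠ 0 := (map_ne_zero _).2 hlam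
  have hUn := hU n
  rw [mul_add, hsucc, hpred, hvd, hv n t]
  simp only [← mul_conj] at hUn ⊢
  simp only [ALW, star_def, map_mul, map_add, map_sub, map_neg, map_inv₀, map_pow, map_div₀,
    map_one, map_ofNat, conj_ofReal, conj_conj, conj_I, Nat.cast_ofNat, Nat.add_one_sub_one,
    pow_one]
  linear_combination (norm := (field_simp; ring_nf; simp only [I_sq]; ring))
    (P n t * Q n t + conj (P n t) * conj (Q n t)) * hUn
end

section
/- Let ω ∈ ℝ, let {U_n}_{n∈ℤ} ⊂ ℂ satisfy (1+|U_n|²)(U_{n+1}+U_{n-1}) = 2ω U_n for all n, let λ ∈ ℂ\{0} and Ω ∈ ℂ. Suppose (P̂_n, Q̂_n), n ∈ ℤ, are time-independent complex numbers such that (P_n(t), Q_n(t)) := (P̂_n e^{Ωt}, Q̂_n e^{Ωt}) solves the separated Lax system. Then V_n := λ P̂_n² + U_n P̂_n Q̂_n and Ṽ_n := −λ^{-1} Q̂_n² + conj(U_n) P̂_n Q̂_n satisfy the spectral stability problem i Λ V_n − 2ω V_n + (1+|U_n|²)(V_{n+1}+V_{n-1}) + (U_{n+1}+U_{n-1})(U_n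 Ṽ_n + conj(U_n) V_n) = 0 and −i Λ Ṽ_n − 2ω Ṽ_n + (1+|U_n|²)(Ṽ_{n+1}+Ṽ_{n-1}) + (conj(U_{n+1})+conj(U_{n-1}))(conj(U_n) V_n + U_n Ṽ_n) = 0 with Λ = 2Ω. -/
open Complex ComplexConjugate

/-- `√(1 + |z|²)`, as a complex number, is nonzero. -/
theorem sqrt_one_add_normSq_ne_zero (z : ℂ) :
    ((Real.sqrt (1 + Complex.normSq z) : ℝ) : ℂ) ≠ 0 := by
  have h : 0 < 1 + Complex.normSq z := by linarith [Complex.normSq_nonneg z]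
  exact Complex.ofReal_ne_zero.mpr (ne_of_gt (Real.sqrt_pos.mpr h))

/-- The square of `√(1 + |z|²)` is `1 + z conj z`. -/
theorem sqrt_one_add_normSq_sq (z : ℂ) :
    ((Real.sqrt (1 + Complex.normSq z) : ℝ) : ℂ) ^ 2 = 1 + z * conj z := by
  have h : 0 ≤ 1 + Complex.normSq z := by linarith [Complex.normSq_nonneg z]
  rw [Complex.mul_conj, ← Complex.ofReal_pow, Real.sq_sqrt h]
  push_cast
  rfl

/-- If `c e^{Ωs}` has derivative `d` at `s = 0`, then `d = cΩ`. -/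
theorem eq_mul_of_hasDerivAt_mul_exp {c Ω d : ℂ}
    (h : HasDerivAt (fun s : ℝ => c * Complex.exp (Ω * s)) d (0 : ℝ)) : d = c * Ω := by
  have h1 : HasDerivAt (fun s : ℝ => Ω * (s : ℂ)) Ω (0 : ℝ) := by
    simpa using (Complex.ofRealCLM.hasDerivAt (x := (0 : ℝ))).const_mul Ω
  have h2 := (h1.cexp).const_mul c
  simpa using h.unique h2

/-- Corollary 1 of the paper, first solution. If
`(Pₙ(t), Qₙ(t)) = (P̂ₙ e^{Ωt}, Q̂ₙ e^{Ωt})` solves the separated Lax system associated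
with a standing wave `{Uₙ}` of the Ablowitz–Ladik equation, then
`Vₙ = λP̂ₙ² + Uₙ P̂ₙ Q̂ₙ`, `Ṽₙ = −λ⁻¹Q̂ₙ² + conj(Uₙ) P̂ₙ Q̂ₙ` solve the spectral
stability problem with `Λ = 2Ω`. -/
theorem squared_eigenfunctions_solve_stability_problem
    (ω : ℝ) (U : ℤ → ℂ)
    (hU : ∀ n : ℤ, (1 + (Complex.normSq (U n) : ℂ)) * (U (n + 1) + U (n - 1))
      = 2 * (ω : ℂ) * U n)
    (lam : ℂ) (hlam : lam ≠ 0) (Ω : ℂ) (Phat Qhat : ℤ → ℂ)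
    (hspace : ∀ (n : ℤ) (t : ℝ),
      Phat (n + 1) * Complex.exp (Ω * t) = ((Real.sqrt (1 + Complex.normSq (U n)) : ℂ))⁻¹
          * (lam * (Phat n * Complex.exp (Ω * t)) + U n * (Qhat n * Complex.exp (Ω * t)))
      ∧ Qhat (n + 1) * Complex.exp (Ω * t) = ((Real.sqrt (1 + Complex.normSq (U n)) : ℂ))⁻¹
          * (-conj (U n) * (Phat n * Complex.exp (Ω * t))
              + lam⁻¹ * (Qhat n * Complex.exp (Ω * t))))
    (htime : ∀ (n : ℤ) (t : ℝ),
      HasDerivAt (fun s : ℝ => Phat n * Complex.exp (Ω * s))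
        (Complex.I * ((ALW (U n) (U (n - 1)) lam - (ω : ℂ)) * (Phat n * Complex.exp (Ω * t))
          + (lam * U n - lam⁻¹ * U (n - 1)) * (Qhat n * Complex.exp (Ω * t)))) t
      ∧ HasDerivAt (fun s : ℝ => Qhat n * Complex.exp (Ω * s))
        (Complex.I * ((-lam * conj (U (n - 1)) + lam⁻¹ * conj (U n))
              * (Phat n * Complex.exp (Ω * t))
          + ((ω : ℂ) - ALW (U n) (U (n - 1)) lam) * (Qhat n * Complex.exp (Ω * t)))) t)
    (V Vt : ℤ → ℂ)
    (hV : ∀ n : ℤ, V n = lam * (Phat n) ^ 2 + U n * Phat n * Qhat n)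
    (hVt : ∀ n : ℤ, Vt n = -lam⁻¹ * (Qhat n) ^ 2 + conj (U n) * Phat n * Qhat n)
    (Λ : ℂ) (hΛ : Λ = 2 * Ω) :
    ∀ n : ℤ,
      Complex.I * Λ * V n - 2 * (ω : ℂ) * V n
          + (1 + (Complex.normSq (U n) : ℂ)) * (V (n + 1) + V (n - 1))
          + (U (n + 1) + U (n - 1)) * (U n * Vt n + conj (U n) * V n) = 0
      ∧ -Complex.I * Λ * Vt n - 2 * (ω : ℂ) * Vt n
          + (1 + (Complex.normSq (U n) : ℂ)) * (Vt (n + 1) + Vt (n - 1))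
          + (conj (U (n + 1)) + conj (U (n - 1))) * (conj (U n) * V n + U n * Vt n) = 0 := by
  have hP (n : ℤ) : (Real.sqrt (1 + Complex.normSq (U n)) : ℂ) * Phat (n + 1)
      = lam * Phat n + U n * Qhat n := by
    have h := (hspace n 0).1
    simp only [Complex.ofReal_zero, mul_zero, Complex.exp_zero, mul_one] at h
    rw [h, mul_inv_cancel_left₀ (sqrt_one_add_normSq_ne_zero (U n))]
  have hQ (n : ℤ) : (Real.sqrt (1 + Complex.normSq (U n)) : ℂ) * Qhat (n + 1)
      = -conj (U n) * Phat n + lam⁻¹ * Qhat n := by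
    have h := (hspace n 0).2
    simp only [Complex.ofReal_zero, mul_zero, Complex.exp_zero, mul_one] at h
    rw [h, mul_inv_cancel_left₀ (sqrt_one_add_normSq_ne_zero (U n))]
  intro n
  have hl : lam * lam⁻¹ = 1 := mul_inv_cancel₀ hlam
  have hp := eq_mul_of_hasDerivAt_mul_exp (htime n 0).1
  have hq := eq_mul_of_hasDerivAt_mul_exp (htime n 0).2
  simp only [Complex.ofReal_zero, mul_zero, Complex.exp_zero, mul_one, ALW] at hp hq
  have hu := hU n
  have huc := congrArg conj hu
  simp only [map_mul, map_add, map_one, map_ofNat, Complex.conj_ofReal] at huc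
  rw [← Complex.mul_conj] at hu huc ⊢
  have hPn := hP n
  have hQn := hQ n
  have hsn := sqrt_one_add_normSq_sq (U n)
  have hPm := hP (n - 1)
  have hQm := hQ (n - 1)
  have hsm := sqrt_one_add_normSq_sq (U (n - 1))
  have hsm0 := sqrt_one_add_normSq_ne_zero (U (n - 1))
  rw [sub_add_cancel] at hPm hQm
  rw [hV, hV, hV, hVt, hVt, hVt, hΛ]
  generalize (Real.sqrt (1 + Complex.normSq (U n)) : ℂ) = s at *
  generalize (Real.sqrt (1 + Complex.normSq (U (n - 1))) : ℂ) = r at *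
  generalize lam⁻¹ = m at *
  have hI := Complex.I_sq
  generalize Complex.I = I at *
  generalize Phat (n + 1) = pp at *
  generalize Qhat (n + 1) = qq at *
  generalize Phat (n - 1) = pm at *
  generalize Qhat (n - 1) = qm at *
  generalize Phat n = p at *
  generalize Qhat n = q at *
  generalize conj (U n) = A at *
  generalize conj (U (n - 1)) = B at *
  generalize conj (U (n + 1)) = C at *
  generalize U n = a at *
  generalize U (n - 1) = b at *
  generalize U (n + 1) = c at *
  generalize (ω : ℂ) = w at *
  have hpm : r * pm = m * p - b * q := by
    apply mul_left_cancel₀ hsm0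
    linear_combination pm * hsm - m * hPm + b * hQm - pm * hl
  have hqm : r * qm = B * p + lam * q := by
    apply mul_left_cancel₀ hsm0
    linear_combination qm * hsm - B * hPm - lam * hQm - qm * hl
  have hVm : lam * pm ^ 2 + b * pm * qm = p * (m * p - b * q) := by
    linear_combination p * hpm - pm * hPm
  have hVtm : -m * qm ^ 2 + B * pm * qm = -q * (B * p + lam * q) := by
    linear_combination qm * hQm - q * hqm
  have hVp : (1 + a * A) * (lam * pp ^ 2 + c * pp * qq)
      = lam * (lam * p + a * q) ^ 2 + c * (lam * p + a * q) * (-A * p + m * q) := by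
    rw [← hPn, ← hQn, ← hsn]; ring
  have hVtp : (1 + a * A) * (-m * qq ^ 2 + C * pp * qq)
      = -m * (-A * p + m * q) ^ 2 + C * (lam * p + a * q) * (-A * p + m * q) := by
    rw [← hPn, ← hQn, ← hsn]; ring
  constructor
  · linear_combination p * q * hu + hVp + (1 + a * A) * hVm
      - I * (2 * lam * p + a * q) * hp - I * a * p * hq
      + (-p ^ 2 * m + p * q * (2 * b + c)) * hl
      + (2 * lam * p * ((1 / 2 * (lam ^ 2 + m ^ 2 + a * B + A * b) - w) * p
          + (lam * a - m * b) * q)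
        + a * q * ((lam * a - m * b) * q) + a * p * ((-lam * B + m * A) * p)) * hI
  · linear_combination p * q * huc + hVtp + (1 + a * A) * hVtm
      + I * A * q * hp + I * (-2 * m * q + A * p) * hq
      + (q ^ 2 * lam + p * q * (C + 2 * B)) * hl
      - (A * q * ((lam * a - m * b) * q) + A * p * ((-lam * B + m * A) * p)
        - 2 * m * q * ((-lam * B + m * A) * p
          + (w - 1 / 2 * (lam ^ 2 + m ^ 2 + a * B + A * b)) * q)) * hI
end

section
/- Let ω ∈ ℝ, let {U_n}_{n∈ℤ} ⊂ ℂ satisfy (1+|U_n|²)(U_{n+1}+U_{n-1}) = 2ω U_n for all n, let λ ∈ ℂ\{0} and Ω ∈ ℂ. Suppose (P̂_n, Q̂_n), n ∈ ℤ, are time-independent complex numbers such that (P_n(t), Q_n(t)) := (P̂_n e^{Ωt}, Q̂_n e^{Ωt}) solves the separated Lax system. Then V_n := −conj(λ)^{-1} conj(Q̂_n)² + U_n conj(P̂_n) conj(Q̂_n) and Ṽ_n := conj(λ) conj(P̂_n)² + conj(U_n) conj(P̂_n) conj(Q̂_n) satisfy the spectral stability problem i Λ V_n − 2ω V_n + (1+|U_n|²)(V_{n+1}+V_{n-1})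 + (U_{n+1}+U_{n-1})(U_n Ṽ_n + conj(U_n) V_n) = 0 and −i Λ Ṽ_n − 2ω Ṽ_n + (1+|U_n|²)(Ṽ_{n+1}+Ṽ_{n-1}) + (conj(U_{n+1})+conj(U_{n-1}))(conj(U_n) V_n + U_n Ṽ_n) = 0 with Λ = 2·conj(Ω). -/
open Complex ComplexConjugate

/-- The spatial Lax matrix has determinant one after normalization, so it is inverted by its
adjugate. -/
theorem spatial_step_inverse {s m u w p q p' q' : ℂ} (hm : m ≠ 0) (hs : s ≠ 0)
    (hsq : s ^ 2 = 1 + u * w)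
    (hp : p' = s⁻¹ * (m * p + w * q)) (hq : q' = s⁻¹ * (-u * p + m⁻¹ * q)) :
    p = s⁻¹ * (m⁻¹ * p' - w * q') ∧ q = s⁻¹ * (u * p' + m * q') := by
  subst hp hq
  constructor
  · field_simp
    linear_combination m * p * hsq
  · field_simp
    linear_combination q * hsq

/-- The value of the squared eigenfunctions one step to the left, in terms of the eigenfunction
`(p', q')` at the current site. -/
theorem squared_eigenfunction_left {s m u w p q p' q' : ℂ} (hm : m ≠ 0) (hs : s ≠ 0)
    (hsq : s ^ 2 = 1 + u * w)
    (hp : p' = s⁻¹ * (m * p + w * q)) (hq : q' = s⁻¹ * (-u * p + m⁻¹ * q)) :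
    -m⁻¹ * q ^ 2 + u * p * q = -u * p' * q' - m * q' ^ 2 ∧
      m * p ^ 2 + w * p * q = m⁻¹ * p' ^ 2 - w * p' * q' := by
  obtain ⟨h₁, h₂⟩ := spatial_step_inverse hm hs hsq hp hq
  rw [h₁, h₂]
  constructor
  · field_simp
    linear_combination m * (u * p' * q' + m * q' ^ 2) * hsq
  · field_simp
    linear_combination (m * w * p' * q' - p' ^ 2) * hsq

/-- The value of the squared eigenfunctions one step to the right, multiplied by
`s ^ 2 = 1 + u * w`, in terms of the eigenfunction `(p, q)` at the current site. -/
theorem squared_eigenfunction_right {s m u w a b p q p' q' : ℂ} (hs : s ≠ 0)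
    (hsq : s ^ 2 = 1 + u * w)
    (hp : p' = s⁻¹ * (m * p + w * q)) (hq : q' = s⁻¹ * (-u * p + m⁻¹ * q)) :
    (1 + u * w) * (-m⁻¹ * q' ^ 2 + a * p' * q') =
        -m⁻¹ * (-u * p + m⁻¹ * q) ^ 2 + a * (m * p + w * q) * (-u * p + m⁻¹ * q) ∧
      (1 + u * w) * (m * p' ^ 2 + b * p' * q') =
        m * (m * p + w * q) ^ 2 + b * (m * p + w * q) * (-u * p + m⁻¹ * q) := by
  have hinv : s ^ 2 * s⁻¹ ^ 2 = 1 := by field_simp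
  rw [← hsq, hp, hq]
  generalize -u * p + m⁻¹ * q = y
  generalize m * p + w * q = x
  constructor
  · linear_combination (-m⁻¹ * y ^ 2 + a * x * y) * hinv
  · linear_combination (m * x ^ 2 + b * x * y) * hinv

/-- The algebraic identities behind the squared-eigenfunction solution: `a` and `b` stand for the
neighbouring values to the right, `c` and `d` for those to the left, and `κ` for the time exponent
multiplied by the imaginary unit. -/
theorem squared_eigenfunction_identity {m u w a b c d ω κ p q : ℂ} (hm : m ≠ 0)
    (hu : (1 + u * w) * (a + c) = 2 * ω * u) (hw : (1 + u * w) * (b + d) = 2 * ω * w)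
    (hp : κ * p = (1 / 2 * (m ^ 2 + m⁻¹ ^ 2 + w * c + u * d) - ω) * p + (m * w - m⁻¹ * d) * q)
    (hq : κ * q = (-m * c + m⁻¹ * u) * p + (ω - 1 / 2 * (m ^ 2 + m⁻¹ ^ 2 + w * c + u * d)) * q) :
    2 * κ * (-m⁻¹ * q ^ 2 + u * p * q) - 2 * ω * (-m⁻¹ * q ^ 2 + u * p * q)
        + (-m⁻¹ * (-u * p + m⁻¹ * q) ^ 2 + a * (m * p + w * q) * (-u * p + m⁻¹ * q)
          + (1 + u * w) * (-c * p * q - m * q ^ 2))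
        + (a + c) * (u * (m * p ^ 2 + w * p * q) + w * (-m⁻¹ * q ^ 2 + u * p * q)) = 0 ∧
      -(2 * κ) * (m * p ^ 2 + w * p * q) - 2 * ω * (m * p ^ 2 + w * p * q)
        + (m * (m * p + w * q) ^ 2 + b * (m * p + w * q) * (-u * p + m⁻¹ * q)
          + (1 + u * w) * (m⁻¹ * p ^ 2 - d * p * q))
        + (b + d) * (w * (-m⁻¹ * q ^ 2 + u * p * q) + u * (m * p ^ 2 + w * p * q)) = 0 := by
  have hr : m * m⁻¹ = 1 := mul_inv_cancel₀ hm
  generalize m⁻¹ = r at *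
  constructor
  · linear_combination (-2 * r * q + u * p) * hq + u * q * hp + p * q * hu +
      (a * p * q + 2 * c * p * q + m * q ^ 2) * hr
  · linear_combination -(2 * m * p + w * q) * hp - w * p * hq + p * q * hw +
      (b * p * q + 2 * d * p * q - r * p ^ 2) * hr

/-- Corollary 1 of the paper, second solution. If
`(Pₙ(t), Qₙ(t)) = (P̂ₙ e^{Ωt}, Q̂ₙ e^{Ωt})` solves the separated Lax system associated
with a standing wave `{Uₙ}` of the Ablowitz–Ladik equation, then
`Vₙ = −conj(λ)⁻¹ conj(Q̂ₙ)² + Uₙ conj(P̂ₙ) conj(Q̂ₙ)`,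
`Ṽₙ = conj(λ) conj(P̂ₙ)² + conj(Uₙ) conj(P̂ₙ) conj(Q̂ₙ)` solve the spectral
stability problem with `Λ = 2 conj(Ω)`. -/
theorem squared_eigenfunctions_solve_stability_problem_conjugate
    (ω : ℝ) (U : ℤ → ℂ)
    (hU : ∀ n : ℤ, (1 + (Complex.normSq (U n) : ℂ)) * (U (n + 1) + U (n - 1))
      = 2 * (ω : ℂ) * U n)
    (lam : ℂ) (hlam : lam ≠ 0) (Ω : ℂ) (Phat Qhat : ℤ → ℂ)
    (hspace : ∀ (n : ℤ) (t : ℝ),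
      Phat (n + 1) * Complex.exp (Ω * t) = ((Real.sqrt (1 + Complex.normSq (U n)) : ℂ))⁻¹
          * (lam * (Phat n * Complex.exp (Ω * t)) + U n * (Qhat n * Complex.exp (Ω * t)))
      ∧ Qhat (n + 1) * Complex.exp (Ω * t) = ((Real.sqrt (1 + Complex.normSq (U n)) : ℂ))⁻¹
          * (-conj (U n) * (Phat n * Complex.exp (Ω * t))
              + lam⁻¹ * (Qhat n * Complex.exp (Ω * t))))
    (htime : ∀ (n : ℤ) (t : ℝ),
      HasDerivAt (fun s : ℝ => Phat n * Complex.exp (Ω * s))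
        (Complex.I * ((ALW (U n) (U (n - 1)) lam - (ω : ℂ)) * (Phat n * Complex.exp (Ω * t))
          + (lam * U n - lam⁻¹ * U (n - 1)) * (Qhat n * Complex.exp (Ω * t)))) t
      ∧ HasDerivAt (fun s : ℝ => Qhat n * Complex.exp (Ω * s))
        (Complex.I * ((-lam * conj (U (n - 1)) + lam⁻¹ * conj (U n))
              * (Phat n * Complex.exp (Ω * t))
          + ((ω : ℂ) - ALW (U n) (U (n - 1)) lam) * (Qhat n * Complex.exp (Ω * t)))) t)
    (V Vt : ℤ → ℂ)
    (hV : ∀ n : ℤ, V n = -(conj lam)⁻¹ * (conj (Qhat n)) ^ 2 + U n * conj (Phat n) * conj (Qhat n))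
    (hVt : ∀ n : ℤ, Vt n = conj lam * (conj (Phat n)) ^ 2 + conj (U n) * conj (Phat n) * conj (Qhat n))
    (Λ : ℂ) (hΛ : Λ = 2 * conj Ω) :
    ∀ n : ℤ,
      Complex.I * Λ * V n - 2 * (ω : ℂ) * V n
          + (1 + (Complex.normSq (U n) : ℂ)) * (V (n + 1) + V (n - 1))
          + (U (n + 1) + U (n - 1)) * (U n * Vt n + conj (U n) * V n) = 0
      ∧ -Complex.I * Λ * Vt n - 2 * (ω : ℂ) * Vt n
          + (1 + (Complex.normSq (U n) : ℂ)) * (Vt (n + 1) + Vt (n - 1))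
          + (conj (U (n + 1)) + conj (U (n - 1))) * (conj (U n) * V n + U n * Vt n) = 0 := by
  intro n
  have hns (k : ℤ) : (Complex.normSq (U k) : ℂ) = U k * conj (U k) := (Complex.mul_conj _).symm
  have hpos (k : ℤ) : 0 < 1 + Complex.normSq (U k) := by
    have := Complex.normSq_nonneg (U k)
    positivity
  have hs (k : ℤ) : ((Real.sqrt (1 + Complex.normSq (U k)) : ℝ) : ℂ) ≠ 0 :=
    Complex.ofReal_ne_zero.mpr (Real.sqrt_pos.mpr (hpos k)).ne'
  have hsq (k : ℤ) :
      ((Real.sqrt (1 + Complex.normSq (U k)) : ℝ) : ℂ) ^ 2 = 1 + U k * conj (U k) := by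
    rw [← hns, ← Complex.ofReal_pow, Real.sq_sqrt (hpos k).le]
    push_cast
    rfl
  have hm : conj lam ≠ 0 := (map_ne_zero _).mpr hlam
  have hP (k : ℤ) : conj (Phat (k + 1)) = ((Real.sqrt (1 + Complex.normSq (U k)) : ℝ) : ℂ)⁻¹ *
      (conj lam * conj (Phat k) + conj (U k) * conj (Qhat k)) := by
    simpa using congrArg conj (hspace k 0).1
  have hQ (k : ℤ) : conj (Qhat (k + 1)) = ((Real.sqrt (1 + Complex.normSq (U k)) : ℝ) : ℂ)⁻¹ *
      (-U k * conj (Phat k) + (conj lam)⁻¹ * conj (Qhat k)) := by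
    simpa using congrArg conj (hspace k 0).2
  have hexp (c : ℂ) : HasDerivAt (fun s : ℝ => c * Complex.exp (Ω * s)) (c * Ω) 0 := by
    have h : HasDerivAt (fun s : ℝ => Ω * (s : ℂ)) Ω 0 := by
      simpa using (Complex.ofRealCLM.hasDerivAt (x := (0 : ℝ))).const_mul Ω
    simpa using h.cexp.const_mul c
  have hTP := congrArg conj ((hexp (Phat n)).unique (htime n 0).1)
  have hTQ := congrArg conj ((hexp (Qhat n)).unique (htime n 0).2)
  have hUn := hU n
  have hUc := congrArg conj (hU n)
  have hc2 : conj (2 : ℂ) = 2 := map_ofNat _ 2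
  simp only [ALW, Complex.ofReal_zero, mul_zero, Complex.exp_zero, mul_one, map_mul, map_add,
    map_sub, map_neg, map_pow, map_inv₀, map_div₀, map_one, hc2, Complex.conj_I, Complex.conj_conj,
    Complex.conj_ofReal] at hTP hTQ hUc
  rw [hns] at hUn hUc
  have hP' := hP (n - 1)
  have hQ' := hQ (n - 1)
  rw [sub_add_cancel] at hP' hQ'
  obtain ⟨hL, hLt⟩ := squared_eigenfunction_left hm (hs _) (hsq _) hP' hQ'
  obtain ⟨hR, hRt⟩ := squared_eigenfunction_right (a := U (n + 1)) (b := conj (U (n + 1)))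
    (hs _) (hsq _) (hP n) (hQ n)
  have hI := Complex.I_mul_I
  obtain ⟨h₁, h₂⟩ := squared_eigenfunction_identity (κ := Complex.I * conj Ω)
    (p := conj (Phat n)) (q := conj (Qhat n)) hm hUn hUc
    (by linear_combination Complex.I * hTP - ((1 / 2 * (conj lam ^ 2 + (conj lam)⁻¹ ^ 2 +
      conj (U n) * U (n - 1) + U n * conj (U (n - 1))) - ω) * conj (Phat n) +
      (conj lam * conj (U n) - (conj lam)⁻¹ * conj (U (n - 1))) * conj (Qhat n)) * hI)
    (by linear_combination Complex.I * hTQ - ((-conj lam * U (n - 1) +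
      (conj lam)⁻¹ * U n) * conj (Phat n) + (ω - 1 / 2 * (conj lam ^ 2 + (conj lam)⁻¹ ^ 2 + conj (U n) * U (n - 1) +
      U n * conj (U (n - 1)))) * conj (Qhat n)) * hI)
  simp only [hns, hΛ]
  rw [mul_add (1 + U n * conj (U n)), mul_add (1 + U n * conj (U n))]
  rw [hV (n + 1), hVt (n + 1), hV (n - 1), hVt (n - 1), hR, hRt, hL, hLt, hV n, hVt n]
  constructor
  · linear_combination h₁
  · linear_combination h₂
end

section
/- Let ω ∈ ℝ, let {U_n}_{n∈ℤ} ⊂ ℂ satisfy (1+|U_n|²)(U_{n+1}+U_{n-1}) = 2ω U_n for all n, with conserved quantities F_0 := i(U_n conj(U_{n-1}) − conj(U_n) U_{n-1}) and F_1 := ω(U_n conj(U_{n-1}) + conj(U_n) U_{n-1}) − |U_n|² − |U_{n-1}|² − |U_n|²|U_{n-1}|² (independent of n). Let λ ∈ ℂ\{0}, Ω ∈ ℂ, and suppose that for some n ∈ ℤ there is a pair (P̂_n, Q̂_n) ≠ (0,0) with ΩP̂_n = i[(W_n − ω)P̂_n + (λU_n − λ^{-1}U_{n-1})Q̂_n]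 and ΩQ̂_n = i[(−λ conj(U_{n-1}) + λ^{-1} conj(U_n))P̂_n + (ω − W_n)Q̂_n], where W_n := ½(λ² + λ^{-2} + U_n conj(U_{n-1}) + conj(U_n) U_{n-1}). Then Ω² + Q(λ) = 0, where Q(λ) := ¼(λ² + λ^{-2})² − ω(λ² + λ^{-2}) + ω² + (i/2)F_0(λ² − λ^{-2}) − ¼F_0² − F_1. -/
open Complex ComplexConjugate

/-- The characteristic equation of a traceless `2 × 2` system `Ω v = i [[A, B], [C, -A]] v`
with a nonzero solution `v = (p, q)`. -/
lemma sq_add_sq_add_mul_eq_zero_of_traceless_eigenvector {A B C Ω p q : ℂ}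
    (hne : (p, q) ≠ (0, 0)) (h1 : Ω * p = I * (A * p + B * q))
    (h2 : Ω * q = I * (C * p - A * q)) : Ω ^ 2 + A ^ 2 + B * C = 0 := by
  have hp : (Ω ^ 2 + A ^ 2 + B * C) * p = 0 := by
    linear_combination (Ω + I * A) * h1 + I * B * h2 + (A ^ 2 + B * C) * p * I_sq
  have hq : (Ω ^ 2 + A ^ 2 + B * C) * q = 0 := by
    linear_combination (Ω - I * A) * h2 + I * C * h1 + (A ^ 2 + B * C) * q * I_sq
  by_contra hD
  exact hne (Prod.ext ((mul_eq_zero.mp hp).resolve_left hD) ((mul_eq_zero.mp hq).resolve_left hD))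

/-- Corollary 2 of the paper. If the time part of the separated Lax
system at a standing wave of the Ablowitz–Ladik equation admits a nonzero solution
`(P̂ₙ, Q̂ₙ)` after separation of variables with parameter `Ω`, then
`Ω² + Q(λ) = 0` with
`Q(λ) = ¼(λ²+λ⁻²)² − ω(λ²+λ⁻²) + ω² + (i/2)F₀(λ²−λ⁻²) − ¼F₀² − F₁`. -/
theorem stability_spectrum_relation
    (ω : ℝ) (U : ℤ → ℂ)
    (hU : ∀ m : ℤ, (1 + (Complex.normSq (U m) : ℂ)) * (U (m + 1) + U (m - 1))
      = 2 * (ω : ℂ) * U m)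
    (F₀ F₁ : ℂ)
    (hF₀ : ∀ m : ℤ, F₀ = Complex.I * (U m * conj (U (m - 1)) - conj (U m) * U (m - 1)))
    (hF₁ : ∀ m : ℤ, F₁ = (ω : ℂ) * (U m * conj (U (m - 1)) + conj (U m) * U (m - 1))
      - (Complex.normSq (U m) : ℂ) - (Complex.normSq (U (m - 1)) : ℂ)
      - (Complex.normSq (U m) : ℂ) * (Complex.normSq (U (m - 1)) : ℂ))
    (lam : ℂ) (hlam : lam ≠ 0) (Ω : ℂ) (n : ℤ) (Phat Qhat : ℂ)
    (hne : (Phat, Qhat) ≠ (0, 0))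
    (h1 : Ω * Phat = Complex.I * ((ALW (U n) (U (n - 1)) lam - (ω : ℂ)) * Phat
      + (lam * U n - lam⁻¹ * U (n - 1)) * Qhat))
    (h2 : Ω * Qhat = Complex.I * ((-lam * conj (U (n - 1)) + lam⁻¹ * conj (U n)) * Phat
      + ((ω : ℂ) - ALW (U n) (U (n - 1)) lam) * Qhat)) :
    Ω ^ 2 + ((1 / 4 : ℂ) * (lam ^ 2 + lam⁻¹ ^ 2) ^ 2 - (ω : ℂ) * (lam ^ 2 + lam⁻¹ ^ 2)
      + (ω : ℂ) ^ 2 + Complex.I / 2 * F₀ * (lam ^ 2 - lam⁻¹ ^ 2)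
      - (1 / 4 : ℂ) * F₀ ^ 2 - F₁) = 0 := by
  have hD := sq_add_sq_add_mul_eq_zero_of_traceless_eigenvector hne h1
    (C := -lam * conj (U (n - 1)) + lam⁻¹ * conj (U n)) (by linear_combination h2)
  have hinv : lam * lam⁻¹ = 1 := mul_inv_cancel₀ hlam
  have hF := hF₁ n
  rw [normSq_eq_conj_mul_self, normSq_eq_conj_mul_self] at hF
  rw [hF₀ n, hF]
  unfold ALW at hD
  generalize conj (U n) = cU, conj (U (n - 1)) = cV at *
  linear_combination hD - (U n * cU + U (n - 1) * cV) * hinv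
    + ((1 / 2 : ℂ) * (U n * cV - cU * U (n - 1)) * (lam ^ 2 - lam⁻¹ ^ 2)
      - (1 / 4 : ℂ) * (U n * cV - cU * U (n - 1)) ^ 2) * I_sq
end

section
/- Let ω ∈ ℝ and let {U_n}_{n∈ℤ} ⊂ ℂ satisfy (1+|U_n|²)(U_{n+1}+U_{n-1}) = 2ω U_n for all n, with U_n conj(U_{n-1}) ∈ ℝ for all n (i.e. F_0 = 0) and with conserved quantity F_1 := ω(U_n conj(U_{n-1}) + conj(U_n) U_{n-1}) − |U_n|² − |U_{n-1}|² − |U_n|²|U_{n-1}|². Let σ_1 ∈ {+1, −1}, let r be a fixed square root of F_1, and let λ_1 ∈ ℂ\{0} satisfy ω = ½(λ_1² + λ_1^{-2}) + σ_1 r. Define a_n := λ_1 U_n − λ_1^{-1} U_{n-1}, b_n := λ_1 conj(U_{n-1}) − λ_1^{-1} conj(U_n), c_n := σ_1 r − ½(U_n conj(U_{n-1}) + conj(U_n) U_{n-1}). Then for all n ∈ ℤ: (i) W_n − ω = −c_n, where W_n := ½(λ_1² + λ_1^{-2} + U_n conj(U_{n-1}) + conj(U_n) U_{n-1}); (ii)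 c_n² = a_n b_n; (iii) (1+|U_n|²) a_{n+1} = λ_1² a_n + 2λ_1 U_n c_n + U_n² b_n; (iv) (1+|U_n|²) b_{n+1} = conj(U_n)² a_n − 2λ_1^{-1} conj(U_n) c_n + λ_1^{-2} b_n; (v) (1+|U_n|²) c_{n+1} = −λ_1 conj(U_n) a_n + (1−|U_n|²) c_n + λ_1^{-1} U_n b_n. -/
open Complex ComplexConjugate

/-- Lemma 3 of the paper. For a standing wave with trivial phase
(`F₀ = 0`) and a band-edge eigenvalue `λ₁` with `ω = ½(λ₁²+λ₁⁻²) + σ₁√F₁`, the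
quantities `aₙ = λ₁Uₙ − λ₁⁻¹Uₙ₋₁`, `bₙ = λ₁ conj(Uₙ₋₁) − λ₁⁻¹ conj(Uₙ)`,
`cₙ = σ₁√F₁ − ½(Uₙ conj(Uₙ₋₁) + conj(Uₙ)Uₙ₋₁)` satisfy the identities expressing that
`Pₙ² = aₙ`, `Qₙ² = bₙ`, `PₙQₙ = cₙ` defines a time-independent eigenfunction of the
separated Lax system. -/
theorem band_edge_eigenfunction_identities
    (ω : ℝ) (U : ℤ → ℂ)
    (hU : ∀ m : ℤ, (1 + (Complex.normSq (U m) : ℂ)) * (U (m + 1) + U (m - 1))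
      = 2 * (ω : ℂ) * U m)
    (hreal : ∀ m : ℤ, (U m * conj (U (m - 1))).im = 0)
    (F₁ : ℂ)
    (hF₁ : ∀ m : ℤ, F₁ = (ω : ℂ) * (U m * conj (U (m - 1)) + conj (U m) * U (m - 1))
      - (Complex.normSq (U m) : ℂ) - (Complex.normSq (U (m - 1)) : ℂ)
      - (Complex.normSq (U m) : ℂ) * (Complex.normSq (U (m - 1)) : ℂ))
    (σ₁ : ℝ) (hσ₁ : σ₁ = 1 ∨ σ₁ = -1)
    (r : ℂ) (hr : r ^ 2 = F₁)
    (lam₁ : ℂ) (hlam₁ : lam₁ ≠ 0)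
    (hω : (ω : ℂ) = (1 / 2 : ℂ) * (lam₁ ^ 2 + lam₁⁻¹ ^ 2) + (σ₁ : ℂ) * r)
    (a b c : ℤ → ℂ)
    (ha : ∀ m : ℤ, a m = lam₁ * U m - lam₁⁻¹ * U (m - 1))
    (hb : ∀ m : ℤ, b m = lam₁ * conj (U (m - 1)) - lam₁⁻¹ * conj (U m))
    (hc : ∀ m : ℤ, c m = (σ₁ : ℂ) * r
      - (1 / 2 : ℂ) * (U m * conj (U (m - 1)) + conj (U m) * U (m - 1))) :
    ∀ n : ℤ,
      ALW (U n) (U (n - 1)) lam₁ - (ω : ℂ) = -c n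
      ∧ (c n) ^ 2 = a n * b n
      ∧ (1 + (Complex.normSq (U n) : ℂ)) * a (n + 1)
          = lam₁ ^ 2 * a n + 2 * lam₁ * U n * c n + (U n) ^ 2 * b n
      ∧ (1 + (Complex.normSq (U n) : ℂ)) * b (n + 1)
          = (conj (U n)) ^ 2 * a n - 2 * lam₁⁻¹ * conj (U n) * c n + lam₁⁻¹ ^ 2 * b n
      ∧ (1 + (Complex.normSq (U n) : ℂ)) * c (n + 1)
          = -lam₁ * conj (U n) * a n + (1 - (Complex.normSq (U n) : ℂ)) * c n
            + lam₁⁻¹ * U n * b n := by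
  intro n
  have hk : lam₁ * lam₁⁻¹ = 1 := mul_inv_cancel₀ hlam₁
  have hp : U n * conj (U (n - 1)) = conj (U n) * U (n - 1) := by
    simpa using (Complex.conj_eq_iff_im.mpr (hreal n)).symm
  have hs : ((σ₁ : ℂ) * r) ^ 2 = F₁ := by
    rcases hσ₁ with rfl | rfl <;> simp [hr]
  rw [hF₁ n] at hs
  have h := hU n
  have h' : (1 + (Complex.normSq (U n) : ℂ)) * (conj (U (n + 1)) + conj (U (n - 1)))
      = 2 * (ω : ℂ) * conj (U n) := by
    simpa [Complex.conj_ofNat] using congrArg conj h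
  simp only [ALW, ha, hb, hc, add_sub_cancel_right, ← Complex.mul_conj] at *
  generalize lam₁⁻¹ = l at *
  generalize (σ₁ : ℂ) * r = s at *
  generalize conj (U n) = X, conj (U (n - 1)) = Y, conj (U (n + 1)) = Z at *
  generalize U n = x, U (n - 1) = y, U (n + 1) = z at *
  generalize (ω : ℂ) = w at *
  refine ⟨?_, ?_, ?_, ?_, ?_⟩
  · linear_combination -hω
  · grind
  · linear_combination lam₁ * h + 2 * lam₁ * x * hω + (l * x + lam₁ * y) * hk
  · grind
  · linear_combination -(1 / 2) * X * h - (1 / 2) * x * h' - 2 * x * X * hω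
      - (X * y + x * Y) * hk
end

section
/- Let A > 0 and set ω := 1 + A². For Λ ∈ ℂ and θ ∈ ℝ, there exists (V̂, Ṽ̂) ∈ ℂ²\{(0,0)} such that V_n := V̂ e^{2iθn} and Ṽ_n := Ṽ̂ e^{2iθn} satisfy i Λ V_n − 2ω V_n + (1+A²)(V_{n+1}+V_{n-1}) + 2A²(V_n + Ṽ_n) = 0 and −i Λ Ṽ_n − 2ω Ṽ_n + (1+A²)(Ṽ_{n+1}+Ṽ_{n-1}) + 2A²(V_n + Ṽ_n) = 0 for all n ∈ ℤ if and only if Λ² = −4[((1+A²)cos(2θ) + A² − ω)² − A⁴]. Consequently, the set of all such Λ as θ ranges over ℝ equals the union of the real segment [−2(ω−1), 2(ω−1)] and the purely imaginary segment {is : s ∈ [−4√ω, 4√ω]}. -/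
open Complex

/-- The spectral stability problem of the Ablowitz–Ladik equation linearized at the
constant-amplitude wave `Uₙ = A` admits a nontrivial plane-wave solution
`(Vₙ, Ṽₙ) = (V̂ e^{2iθn}, Ṽ̂ e^{2iθn})` with eigenvalue `Λ`. -/
def constantWaveStabilityPlaneWave (A ω : ℝ) (Λ : ℂ) (θ : ℝ) : Prop :=
  ∃ Vhat Vthat : ℂ, (Vhat, Vthat) ≠ (0, 0) ∧ ∀ n : ℤ,
    Complex.I * Λ * (Vhat * Complex.exp (2 * Complex.I * (θ : ℂ) * (n : ℂ)))
        - 2 * (ω : ℂ) * (Vhat * Complex.exp (2 * Complex.I * (θ : ℂ) * (n : ℂ)))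
        + (1 + (A : ℂ) ^ 2) * (Vhat * Complex.exp (2 * Complex.I * (θ : ℂ) * ((n : ℂ) + 1))
            + Vhat * Complex.exp (2 * Complex.I * (θ : ℂ) * ((n : ℂ) - 1)))
        + 2 * (A : ℂ) ^ 2 * (Vhat * Complex.exp (2 * Complex.I * (θ : ℂ) * (n : ℂ))
            + Vthat * Complex.exp (2 * Complex.I * (θ : ℂ) * (n : ℂ))) = 0
    ∧ -Complex.I * Λ * (Vthat * Complex.exp (2 * Complex.I * (θ : ℂ) * (n : ℂ)))
        - 2 * (ω : ℂ) * (Vthat * Complex.exp (2 * Complex.I * (θ : ℂ) * (n : ℂ)))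
        + (1 + (A : ℂ) ^ 2) * (Vthat * Complex.exp (2 * Complex.I * (θ : ℂ) * ((n : ℂ) + 1))
            + Vthat * Complex.exp (2 * Complex.I * (θ : ℂ) * ((n : ℂ) - 1)))
        + 2 * (A : ℂ) ^ 2 * (Vhat * Complex.exp (2 * Complex.I * (θ : ℂ) * (n : ℂ))
            + Vthat * Complex.exp (2 * Complex.I * (θ : ℂ) * (n : ℂ))) = 0

/-- The `2 × 2` matrix `(p, q; q, r)` with `q ≠ 0` has a nontrivial kernel exactly when its
determinant vanishes. -/
theorem exists_ne_zero_kernel_iff_det {p q r : ℂ} (hq : q ≠ 0) :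
    (∃ v w : ℂ, (v, w) ≠ (0, 0) ∧ p * v + q * w = 0 ∧ r * w + q * v = 0) ↔ p * r = q ^ 2 := by
  constructor
  · rintro ⟨v, w, hne, h₁, h₂⟩
    by_contra hdet
    have hdet' : p * r - q ^ 2 ≠ 0 := sub_ne_zero.mpr hdet
    have hv : v = 0 := by
      have : (p * r - q ^ 2) * v = 0 := by linear_combination r * h₁ - q * h₂
      exact (mul_eq_zero.mp this).resolve_left hdet'
    have hw : w = 0 := by
      have : (p * r - q ^ 2) * w = 0 := by linear_combination p * h₂ - q * h₁
      exact (mul_eq_zero.mp this).resolve_left hdet'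
    exact hne (by rw [hv, hw])
  · intro h
    refine ⟨q, -p, fun h0 => hq (congrArg Prod.fst h0), by ring, ?_⟩
    linear_combination -h

theorem exp_shift_add_exp_shift (θ : ℝ) (n : ℂ) :
    Complex.exp (2 * Complex.I * (θ : ℂ) * (n + 1))
        + Complex.exp (2 * Complex.I * (θ : ℂ) * (n - 1))
      = 2 * (Real.cos (2 * θ) : ℂ) * Complex.exp (2 * Complex.I * (θ : ℂ) * n) := by
  have h₁ : 2 * Complex.I * (θ : ℂ) * (n + 1)
      = (2 * (θ : ℂ)) * Complex.I + 2 * Complex.I * (θ : ℂ) * n := by ring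
  have h₂ : 2 * Complex.I * (θ : ℂ) * (n - 1)
      = -(2 * (θ : ℂ)) * Complex.I + 2 * Complex.I * (θ : ℂ) * n := by ring
  rw [h₁, h₂, Complex.exp_add, Complex.exp_add]
  push_cast
  rw [Complex.two_cos]
  ring

theorem constantWaveStabilityPlaneWave_iff {A : ℝ} (hA : A ≠ 0) (ω : ℝ) (Λ : ℂ) (θ : ℝ) :
    constantWaveStabilityPlaneWave A ω Λ θ
      ↔ Λ ^ 2 = -4 * ((((1 + A ^ 2) * Real.cos (2 * θ) + A ^ 2 - ω : ℝ) : ℂ) ^ 2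
          - (A : ℂ) ^ 4) := by
  have hq : 2 * (A : ℂ) ^ 2 ≠ 0 := by simpa using hA
  set b : ℂ := (((1 + A ^ 2) * Real.cos (2 * θ) + A ^ 2 - ω : ℝ) : ℂ) with hb
  have hb' : b = (1 + (A : ℂ) ^ 2) * (Real.cos (2 * θ) : ℂ) + (A : ℂ) ^ 2 - ω := by
    rw [hb]; push_cast; ring
  have key : constantWaveStabilityPlaneWave A ω Λ θ ↔
      ∃ v w : ℂ, (v, w) ≠ (0, 0) ∧ (Complex.I * Λ + 2 * b) * v + 2 * (A : ℂ) ^ 2 * w = 0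
        ∧ (-Complex.I * Λ + 2 * b) * w + 2 * (A : ℂ) ^ 2 * v = 0 := by
    refine exists_congr fun v => exists_congr fun w => and_congr_right fun _ => ?_
    constructor
    · intro h
      obtain ⟨h₁, h₂⟩ := h 0
      have hs := exp_shift_add_exp_shift θ ((0 : ℤ) : ℂ)
      have he : Complex.exp (2 * Complex.I * (θ : ℂ) * ((0 : ℤ) : ℂ)) = 1 := by simp
      rw [he] at h₁ h₂ hs
      exact ⟨by linear_combination h₁ - (1 + (A : ℂ) ^ 2) * v * hs + 2 * v * hb',
        by linear_combination h₂ - (1 + (A : ℂ) ^ 2) * w * hs + 2 * w * hb'⟩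
    · rintro ⟨h₁, h₂⟩ n
      have hs := exp_shift_add_exp_shift θ (n : ℂ)
      set e := Complex.exp (2 * Complex.I * (θ : ℂ) * (n : ℂ))
      exact ⟨by linear_combination e * h₁ + (1 + (A : ℂ) ^ 2) * v * hs - 2 * v * e * hb',
        by linear_combination e * h₂ + (1 + (A : ℂ) ^ 2) * w * hs - 2 * w * e * hb'⟩
  rw [key, exists_ne_zero_kernel_iff_det hq]
  constructor <;> intro h
  · linear_combination h + Λ ^ 2 * Complex.I_sq
  · linear_combination h - Λ ^ 2 * Complex.I_sq

/-- The values of `4 (A⁴ - (ω cos 2θ - 1)²)`, with `ω = 1 + A²`, fill `[-16 ω, 4 A⁴]`. -/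
theorem exists_cos_symbol_iff (A r : ℝ) :
    (∃ θ : ℝ, r = -4 * (((1 + A ^ 2) * Real.cos (2 * θ) + A ^ 2 - (1 + A ^ 2)) ^ 2 - A ^ 4))
      ↔ r ∈ Set.Icc (-(16 * (1 + A ^ 2))) (4 * A ^ 4) := by
  have hω : 0 < 1 + A ^ 2 := by positivity
  constructor
  · rintro ⟨θ, rfl⟩
    have h₁ := Real.neg_one_le_cos (2 * θ)
    have h₂ := Real.cos_le_one (2 * θ)
    set c := Real.cos (2 * θ)
    have h₃ : 0 ≤ (1 + A ^ 2) * (1 + c) := mul_nonneg hω.le (by linarith)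
    have h₄ : 0 ≤ (1 + A ^ 2) * (1 - c) := mul_nonneg hω.le (by linarith)
    constructor
    · nlinarith [mul_nonneg h₃ h₄, sq_nonneg A]
    · nlinarith [sq_nonneg ((1 + A ^ 2) * c + A ^ 2 - (1 + A ^ 2))]
  · rintro ⟨h₁, h₂⟩
    have hd : 0 ≤ A ^ 4 - r / 4 := by linarith
    set d := Real.sqrt (A ^ 4 - r / 4)
    have hd0 : 0 ≤ d := Real.sqrt_nonneg _
    have hd_sq : d ^ 2 = A ^ 4 - r / 4 := Real.sq_sqrt hd
    have hd_le : d ≤ A ^ 2 + 2 :=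
      Real.sqrt_le_iff.mpr ⟨by positivity, by nlinarith⟩
    refine ⟨Real.arccos ((1 - d) / (1 + A ^ 2)) / 2, ?_⟩
    rw [mul_div_cancel₀ _ (two_ne_zero), Real.cos_arccos, mul_div_cancel₀ _ hω.ne']
    · linear_combination 4 * hd_sq
    · rw [le_div_iff₀ hω]; linarith
    · rw [div_le_one hω]; nlinarith [sq_nonneg A]

/-- stability spectrum of the constant-amplitude wave, Lemma 4 of
the paper. A nontrivial plane-wave solution of the stability problem at the
constant-amplitude wave `Uₙ = A`, `ω = 1 + A²` exists if and only if
`Λ² = −4[((1+A²)cos 2θ + A² − ω)² − A⁴]`; consequently the stability spectrum is the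
union of the real segment `[−2(ω−1), 2(ω−1)]` and the purely imaginary segment
`i[−4√ω, 4√ω]`. -/
theorem constant_wave_stability_spectrum (A : ℝ) (hA : 0 < A) (ω : ℝ)
    (hω : ω = 1 + A ^ 2) :
    (∀ (Λ : ℂ) (θ : ℝ),
      (constantWaveStabilityPlaneWave A ω Λ θ
        ↔ Λ ^ 2 = -4 * ((((1 + A ^ 2) * Real.cos (2 * θ) + A ^ 2 - ω : ℝ) : ℂ) ^ 2
            - (A : ℂ) ^ 4)))
    ∧ {Λ : ℂ | ∃ θ : ℝ, constantWaveStabilityPlaneWave A ω Λ θ}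
        = (Complex.ofReal '' Set.Icc (-(2 * (ω - 1))) (2 * (ω - 1)))
          ∪ ((fun s : ℝ => Complex.I * (s : ℂ)) ''
              Set.Icc (-(4 * Real.sqrt ω)) (4 * Real.sqrt ω)) := by
  subst hω
  refine ⟨fun Λ θ => constantWaveStabilityPlaneWave_iff hA.ne' _ Λ θ, ?_⟩
  have hsqrt : Real.sqrt (1 + A ^ 2) ^ 2 = 1 + A ^ 2 := Real.sq_sqrt (by positivity)
  have hsqrt0 : 0 ≤ 4 * Real.sqrt (1 + A ^ 2) := by positivity
  have hA2 : 0 ≤ 2 * (1 + A ^ 2 - 1) := by nlinarith [sq_nonneg A]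
  ext Λ
  simp only [Set.mem_ofPred_eq, Set.mem_union, Set.mem_image,
    constantWaveStabilityPlaneWave_iff hA.ne']
  constructor
  · rintro ⟨θ, h⟩
    obtain ⟨h₁, h₂⟩ := (exists_cos_symbol_iff A _).mp ⟨θ, rfl⟩
    set r : ℝ :=
      -4 * (((1 + A ^ 2) * Real.cos (2 * θ) + A ^ 2 - (1 + A ^ 2)) ^ 2 - A ^ 4) with hr
    have hΛ : Λ ^ 2 = (r : ℂ) := by rw [h, hr]; push_cast; ring
    have hre : Λ.re * Λ.re - Λ.im * Λ.im = r := by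
      simpa [pow_two] using congrArg Complex.re hΛ
    have him : Λ.re * Λ.im + Λ.im * Λ.re = 0 := by
      simpa [pow_two] using congrArg Complex.im hΛ
    rcases mul_eq_zero.mp (show Λ.re * Λ.im = 0 by linarith) with h0 | h0
    · refine Or.inr ⟨Λ.im, abs_le.mp (abs_le_of_sq_le_sq ?_ hsqrt0), ?_⟩
      · rw [h0] at hre
        nlinarith
      · apply Complex.ext <;> simp [h0]
    · refine Or.inl ⟨Λ.re, abs_le.mp (abs_le_of_sq_le_sq ?_ hA2), ?_⟩
      · rw [h0] at hre
        nlinarith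
      · apply Complex.ext <;> simp [h0]
  · have of_sq : ∀ r : ℝ, Λ ^ 2 = (r : ℂ) → r ∈ Set.Icc (-(16 * (1 + A ^ 2))) (4 * A ^ 4) →
        ∃ θ : ℝ, Λ ^ 2 = -4 * ((((1 + A ^ 2) * Real.cos (2 * θ) + A ^ 2 - (1 + A ^ 2) : ℝ) : ℂ) ^ 2
          - (A : ℂ) ^ 4) := by
      intro r hΛ hr
      obtain ⟨θ, hθ⟩ := (exists_cos_symbol_iff A r).mpr hr
      refine ⟨θ, ?_⟩
      rw [hΛ, hθ]
      push_cast
      ring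
    rintro (⟨x, hx, rfl⟩ | ⟨s, hs, rfl⟩)
    · have hx2 := sq_le_sq' hx.1 hx.2
      exact of_sq (x ^ 2) (by push_cast; ring) ⟨by nlinarith [sq_nonneg x, sq_nonneg A], by linarith⟩
    · have hs2 := sq_le_sq' hs.1 hs.2
      refine of_sq (-s ^ 2) ?_ ⟨by linarith, by nlinarith [sq_nonneg s, sq_nonneg (A ^ 2)]⟩
      push_cast
      linear_combination (s : ℂ) ^ 2 * Complex.I_sq
end

section
/- Let ω ∈ ℝ, {U_n}_{n∈ℤ} ⊂ ℂ, λ_1 ∈ ℂ\{0}, and let (P_n(t), Q_n(t)), n ∈ ℤ, be a differentiable solution of the separated Lax system with λ = λ_1 such that |P_n(t)|² + |Q_n(t)|² ≠ 0 and Δ_n(t) ≠ 0 for all n, t, where Δ_n := |λ_1|⁴|P_n|² + |Q_n|² + |λ_1|²|U_n|²(|P_n|² + |Q_n|²) + (|λ_1|² − 1)(conj(λ_1) U_n conj(P_n) Q_n + λ_1 conj(U_n) P_n conj(Q_n)). Let θ_n(t) be differentiable functions satisfying θ_{n+1} − θ_n = (|λ_1|² − 1)(conj(λ_1) U_n conj(P_n)²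 − λ_1 conj(U_n) conj(Q_n)² − (1 + |λ_1|²) conj(P_n) conj(Q_n)) / ((|P_n|² + |Q_n|²)·Δ_n) and dθ_n/dt = i(|λ_1|² − 1)Σ_n / (|λ_1|²(|P_n|² + |Q_n|²)²), where Σ_n := (λ_1 U_n + conj(λ_1) U_{n-1}) conj(P_n)² + (conj(λ_1) conj(U_n) + λ_1 conj(U_{n-1})) conj(Q_n)² − (1 + |λ_1|^{-2})(λ_1² − conj(λ_1)²) conj(P_n) conj(Q_n). Then P̂_n := P_n θ_n − conj(Q_n)/(|P_n|² + |Q_n|²) and Q̂_n := Q_n θ_n + conj(P_n)/(|P_n|² + |Q_n|²) give a second solution of the separated Lax system with the same λ = λ_1. -/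
open Complex ComplexConjugate

/-- `Δₙ = |λ₁|⁴|Pₙ|² + |Qₙ|² + |λ₁|²|Uₙ|²(|Pₙ|²+|Qₙ|²)
      + (|λ₁|²−1)(conj(λ₁)Uₙ conj(Pₙ)Qₙ + λ₁ conj(Uₙ)Pₙ conj(Qₙ))`. -/
noncomputable def ALDelta (lam₁ Un Pn Qn : ℂ) : ℂ :=
  ((Complex.normSq lam₁ : ℂ)) ^ 2 * (Complex.normSq Pn : ℂ) + (Complex.normSq Qn : ℂ)
    + (Complex.normSq lam₁ : ℂ) * (Complex.normSq Un : ℂ)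
      * ((Complex.normSq Pn : ℂ) + (Complex.normSq Qn : ℂ))
    + ((Complex.normSq lam₁ : ℂ) - 1)
      * (conj lam₁ * Un * conj Pn * Qn + lam₁ * conj Un * Pn * conj Qn)

/-- `Σₙ = (λ₁Uₙ + conj(λ₁)Uₙ₋₁) conj(Pₙ)² + (conj(λ₁)conj(Uₙ) + λ₁conj(Uₙ₋₁)) conj(Qₙ)²
      − (1+|λ₁|⁻²)(λ₁² − conj(λ₁)²) conj(Pₙ) conj(Qₙ)`. -/
noncomputable def ALSigma (lam₁ Un Um Pn Qn : ℂ) : ℂ :=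
  (lam₁ * Un + conj lam₁ * Um) * (conj Pn) ^ 2
    + (conj lam₁ * conj Un + lam₁ * conj Um) * (conj Qn) ^ 2
    - (1 + ((Complex.normSq lam₁ : ℂ))⁻¹) * (lam₁ ^ 2 - (conj lam₁) ^ 2)
      * conj Pn * conj Qn

/-- In the lemmas below the complex conjugates of `l, U, V, P, Q` are independent variables
`m, u, v, p, q`. -/
theorem lax_spatial_fst_identity {l m U u P p Q q N D : ℂ} (hm : m ≠ 0)
    (hN : N ≠ 0) (hD : D ≠ 0) (hNe : N = P * p + Q * q)
    (hDe : D = (l * m) ^ 2 * (P * p) + Q * q + l * m * (U * u) * (P * p + Q * q)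
      + (l * m - 1) * (m * U * p * Q + l * u * P * q)) :
    (l * P + U * Q) * ((l * m - 1) * (m * U * p ^ 2 - l * u * q ^ 2
        - (1 + l * m) * p * q) / (N * D))
      - (-U * p + m⁻¹ * q) * (l * m * (1 + U * u) / D)
      = -l * q / N + U * p / N := by
  field_simp
  subst hNe hDe
  ring

theorem lax_spatial_snd_identity {l m U u P p Q q N D : ℂ} (hl : l ≠ 0)
    (hN : N ≠ 0) (hD : D ≠ 0) (hNe : N = P * p + Q * q)
    (hDe : D = (l * m) ^ 2 * (P * p) + Q * q + l * m * (U * u) * (P * p + Q * q)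
      + (l * m - 1) * (m * U * p * Q + l * u * P * q)) :
    (-u * P + l⁻¹ * Q) * ((l * m - 1) * (m * U * p ^ 2 - l * u * q ^ 2
        - (1 + l * m) * p * q) / (N * D))
      + (m * p + u * q) * (l * m * (1 + U * u) / D)
      = u * q / N + l⁻¹ * p / N := by
  field_simp
  subst hNe hDe
  ring

theorem normSq_add_normSq_lax_spatial {r : ℝ} {l U P Q : ℂ} (hl : l ≠ 0)
    (hr : (r : ℂ) ^ 2 = 1 + U * conj U) :
    ((normSq ((r : ℂ)⁻¹ * (l * P + U * Q))
        + normSq ((r : ℂ)⁻¹ * (-conj U * P + l⁻¹ * Q)) : ℝ) : ℂ)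
      = ALDelta l U P Q / (l * conj l * (1 + U * conj U)) := by
  have hm : conj l ≠ 0 := by simpa using hl
  rw [← hr]
  simp only [ALDelta, ofReal_add, ← mul_conj]
  simp only [map_mul, map_add, map_neg, map_inv₀, conj_conj, conj_ofReal]
  by_cases h0 : (r : ℂ) = 0
  · simp [h0]
  · field_simp
    ring

theorem lax_temporal_fst_identity {l m U u V v P p Q q N ω θ : ℂ} (hl : l ≠ 0) (hm : m ≠ 0)
    (hN : N ≠ 0) (hNe : N = P * p + Q * q) :
    let A := 1 / 2 * (l ^ 2 + l⁻¹ ^ 2 + U * v + u * V) - ω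
    let a := 1 / 2 * (m ^ 2 + m⁻¹ ^ 2 + u * V + U * v) - ω
    let B := l * U - l⁻¹ * V
    let b := m * u - m⁻¹ * v
    let C := -l * v + l⁻¹ * u
    let c := -m * V + m⁻¹ * U
    let P' := I * (A * P + B * Q)
    let p' := -I * (a * p + b * q)
    let Q' := I * (C * P + -A * Q)
    let q' := -I * (c * p + -a * q)
    P' * θ + P * (I * (l * m - 1) * ((l * U + m * V) * p ^ 2 + (m * u + l * v) * q ^ 2
        - (1 + (l * m)⁻¹) * (l ^ 2 - m ^ 2) * p * q) / (l * m * N ^ 2))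
      - (q' * N - q * (P' * p + P * p' + (Q' * q + Q * q'))) / N ^ 2
      = I * (A * (P * θ - q / N) + B * (Q * θ + p / N)) := by
  intro A a B b C c P' p' Q' q'
  simp only [A, a, B, b, C, c, P', p', Q', q']
  field_simp
  subst hNe
  ring

theorem lax_temporal_snd_identity {l m U u V v P p Q q N ω θ : ℂ} (hl : l ≠ 0) (hm : m ≠ 0)
    (hN : N ≠ 0) (hNe : N = P * p + Q * q) :
    let A := 1 / 2 * (l ^ 2 + l⁻¹ ^ 2 + U * v + u * V) - ω
    let a := 1 / 2 * (m ^ 2 + m⁻¹ ^ 2 + u * V + U * v) - ω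
    let B := l * U - l⁻¹ * V
    let b := m * u - m⁻¹ * v
    let C := -l * v + l⁻¹ * u
    let c := -m * V + m⁻¹ * U
    let P' := I * (A * P + B * Q)
    let p' := -I * (a * p + b * q)
    let Q' := I * (C * P + -A * Q)
    let q' := -I * (c * p + -a * q)
    Q' * θ + Q * (I * (l * m - 1) * ((l * U + m * V) * p ^ 2 + (m * u + l * v) * q ^ 2
        - (1 + (l * m)⁻¹) * (l ^ 2 - m ^ 2) * p * q) / (l * m * N ^ 2))
      + (p' * N - p * (P' * p + P * p' + (Q' * q + Q * q'))) / N ^ 2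
      = I * (C * (P * θ - q / N) + -A * (Q * θ + p / N)) := by
  intro A a B b C c P' p' Q' q'
  simp only [A, a, B, b, C, c, P', p', Q', q']
  field_simp
  subst hNe
  ring

/-- Lemma 5 of the paper. Given a nonvanishing solution
`(Pₙ(t), Qₙ(t))` of the separated Lax system with `λ = λ₁` and functions `θₙ(t)`
satisfying the stated difference and differential equations, the pair
`P̂ₙ = Pₙθₙ − conj(Qₙ)/(|Pₙ|²+|Qₙ|²)`, `Q̂ₙ = Qₙθₙ + conj(Pₙ)/(|Pₙ|²+|Qₙ|²)` is a
second solution of the separated Lax system with the same `λ = λ₁`. -/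
theorem second_solution_of_Lax_system
    (ω : ℝ) (U : ℤ → ℂ) (lam₁ : ℂ) (hlam₁ : lam₁ ≠ 0)
    (P Q : ℤ → ℝ → ℂ)
    (hspace : ∀ (n : ℤ) (t : ℝ),
      P (n + 1) t = ((Real.sqrt (1 + Complex.normSq (U n)) : ℂ))⁻¹
          * (lam₁ * P n t + U n * Q n t)
      ∧ Q (n + 1) t = ((Real.sqrt (1 + Complex.normSq (U n)) : ℂ))⁻¹
          * (-conj (U n) * P n t + lam₁⁻¹ * Q n t))
    (htime : ∀ (n : ℤ) (t : ℝ),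
      HasDerivAt (fun s => P n s)
        (Complex.I * ((ALW (U n) (U (n - 1)) lam₁ - (ω : ℂ)) * P n t
          + (lam₁ * U n - lam₁⁻¹ * U (n - 1)) * Q n t)) t
      ∧ HasDerivAt (fun s => Q n s)
        (Complex.I * ((-lam₁ * conj (U (n - 1)) + lam₁⁻¹ * conj (U n)) * P n t
          + ((ω : ℂ) - ALW (U n) (U (n - 1)) lam₁) * Q n t)) t)
    (hnz : ∀ (n : ℤ) (t : ℝ), Complex.normSq (P n t) + Complex.normSq (Q n t) ≠ 0)
    (hΔ : ∀ (n : ℤ) (t : ℝ), ALDelta lam₁ (U n) (P n t) (Q n t) ≠ 0)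
    (θ : ℤ → ℝ → ℂ)
    (hθspace : ∀ (n : ℤ) (t : ℝ),
      θ (n + 1) t - θ n t
        = ((Complex.normSq lam₁ : ℂ) - 1)
            * (conj lam₁ * U n * (conj (P n t)) ^ 2 - lam₁ * conj (U n) * (conj (Q n t)) ^ 2
              - (1 + (Complex.normSq lam₁ : ℂ)) * conj (P n t) * conj (Q n t))
          / (((Complex.normSq (P n t) + Complex.normSq (Q n t) : ℝ) : ℂ)
              * ALDelta lam₁ (U n) (P n t) (Q n t)))
    (hθtime : ∀ (n : ℤ) (t : ℝ),
      HasDerivAt (fun s => θ n s)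
        (Complex.I * ((Complex.normSq lam₁ : ℂ) - 1)
            * ALSigma lam₁ (U n) (U (n - 1)) (P n t) (Q n t)
          / ((Complex.normSq lam₁ : ℂ)
              * ((Complex.normSq (P n t) + Complex.normSq (Q n t) : ℝ) : ℂ) ^ 2)) t)
    (Phat Qhat : ℤ → ℝ → ℂ)
    (hPhat : ∀ (n : ℤ) (t : ℝ),
      Phat n t = P n t * θ n t
        - conj (Q n t) / ((Complex.normSq (P n t) + Complex.normSq (Q n t) : ℝ) : ℂ))
    (hQhat : ∀ (n : ℤ) (t : ℝ),
      Qhat n t = Q n t * θ n t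
        + conj (P n t) / ((Complex.normSq (P n t) + Complex.normSq (Q n t) : ℝ) : ℂ)) :
    ∀ (n : ℤ) (t : ℝ),
      (Phat (n + 1) t = ((Real.sqrt (1 + Complex.normSq (U n)) : ℂ))⁻¹
          * (lam₁ * Phat n t + U n * Qhat n t)
        ∧ Qhat (n + 1) t = ((Real.sqrt (1 + Complex.normSq (U n)) : ℂ))⁻¹
          * (-conj (U n) * Phat n t + lam₁⁻¹ * Qhat n t))
      ∧ HasDerivAt (fun s => Phat n s)
          (Complex.I * ((ALW (U n) (U (n - 1)) lam₁ - (ω : ℂ)) * Phat n t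
            + (lam₁ * U n - lam₁⁻¹ * U (n - 1)) * Qhat n t)) t
      ∧ HasDerivAt (fun s => Qhat n s)
          (Complex.I * ((-lam₁ * conj (U (n - 1)) + lam₁⁻¹ * conj (U n)) * Phat n t
            + ((ω : ℂ) - ALW (U n) (U (n - 1)) lam₁) * Qhat n t)) t := by
  have hm : conj lam₁ ≠ 0 := by simpa using hlam₁
  have hN (n : ℤ) (t : ℝ) :
      ((normSq (P n t) + normSq (Q n t) : ℝ) : ℂ)
        = P n t * conj (P n t) + Q n t * conj (Q n t) := by
    simp [mul_conj]
  have hN0 (n : ℤ) (t : ℝ) : ((normSq (P n t) + normSq (Q n t) : ℝ) : ℂ) ≠ 0 :=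
    ofReal_ne_zero.mpr (hnz n t)
  intro n t
  refine ⟨?_, ?_⟩
  · have hS := hspace n t
    set r := Real.sqrt (1 + normSq (U n)) with hrdef
    have hpos : 0 < 1 + normSq (U n) := by linarith [normSq_nonneg (U n)]
    have hr2 : (r : ℂ) ^ 2 = 1 + U n * conj (U n) := by
      rw [mul_conj, ← ofReal_pow, hrdef, Real.sq_sqrt hpos.le]
      simp
    have hD : ALDelta lam₁ (U n) (P n t) (Q n t)
        = (lam₁ * conj lam₁) ^ 2 * (P n t * conj (P n t)) + Q n t * conj (Q n t)
          + lam₁ * conj lam₁ * (U n * conj (U n)) * (P n t * conj (P n t) + Q n t * conj (Q n t))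
          + (lam₁ * conj lam₁ - 1) * (conj lam₁ * U n * conj (P n t) * Q n t
            + lam₁ * conj (U n) * P n t * conj (Q n t)) := by
      simp only [ALDelta, mul_conj]
    have hN1 := normSq_add_normSq_lax_spatial (P := P n t) (Q := Q n t) hlam₁ hr2
    have hθ := eq_add_of_sub_eq' (hθspace n t)
    rw [← mul_conj] at hθ
    have h1 := lax_spatial_fst_identity hm (hN0 n t) (hΔ n t) (hN n t) hD
    have h2 := lax_spatial_snd_identity hlam₁ (hN0 n t) (hΔ n t) (hN n t) hD
    simp only [hPhat, hQhat, hθ, hS.1, hS.2, hN1]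
    simp only [map_mul, map_add, map_neg, map_inv₀, conj_conj, conj_ofReal, div_div_eq_mul_div]
    constructor
    · linear_combination (r : ℂ)⁻¹ * h1
    · linear_combination (r : ℂ)⁻¹ * h2
  · have hP := (htime n t).1
    have hQ := (htime n t).2
    have hp := hP.star
    have hq := hQ.star
    have hNd := (hP.mul hp).add (hQ.mul hq)
    have hθ := hθtime n t
    rw [← mul_conj] at hθ
    have hP0 : P n t * conj (P n t) + Q n t * conj (Q n t) ≠ 0 := hN n t ▸ hN0 n t
    have hPeq : (fun s => Phat n s) = fun s => P n s * θ n s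
        - conj (Q n s) / (P n s * conj (P n s) + Q n s * conj (Q n s)) := by
      funext s
      rw [hPhat, hN]
    have hQeq : (fun s => Qhat n s) = fun s => Q n s * θ n s
        + conj (P n s) / (P n s * conj (P n s) + Q n s * conj (Q n s)) := by
      funext s
      rw [hQhat, hN]
    have h1 := lax_temporal_fst_identity (U := U n) (u := conj (U n)) (V := U (n - 1))
      (v := conj (U (n - 1))) (ω := ω) (θ := θ n t) hlam₁ hm hP0 rfl
    have h2 := lax_temporal_snd_identity (U := U n) (u := conj (U n)) (V := U (n - 1))
      (v := conj (U (n - 1))) (ω := ω) (θ := θ n t) hlam₁ hm hP0 rfl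
    rw [hPeq, hQeq, hPhat, hQhat, hN]
    constructor
    · refine ((hP.mul hθ).sub (hq.div hNd hP0)).congr_deriv ?_
      simp only [ALW, ALSigma, hN, ← mul_conj, ← starRingEnd_apply, Pi.add_apply, Pi.mul_apply,
        map_mul, map_add, map_sub, map_neg, map_inv₀, map_pow, map_div₀, map_one, map_ofNat,
        conj_conj, conj_ofReal, conj_I]
      linear_combination h1
    · refine ((hQ.mul hθ).add (hp.div hNd hP0)).congr_deriv ?_
      simp only [ALW, ALSigma, hN, ← mul_conj, ← starRingEnd_apply, Pi.add_apply, Pi.mul_apply,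
        map_mul, map_add, map_sub, map_neg, map_inv₀, map_pow, map_div₀, map_one, map_ofNat,
        conj_conj, conj_ofReal, conj_I]
      linear_combination h2
end

section
/- Fix n ∈ ℤ, let ω ∈ ℝ, let U_n, U_{n-1} ∈ ℝ, let λ_1 ∈ ℝ\{0}, σ_1 ∈ {+1, −1}, F_1 ≥ 0, and suppose F_1 = 2ω U_n U_{n-1} − U_n² − U_{n-1}² − U_n² U_{n-1}² and ω = ½(λ_1² + λ_1^{-2}) + σ_1 √F_1. Let P_n, Q_n ∈ ℂ satisfy P_n² = λ_1 U_n − λ_1^{-1} U_{n-1}, Q_n² = λ_1 U_{n-1} − λ_1^{-1} U_n, and P_n Q_n = σ_1 √F_1 − U_n U_{n-1}. Then (1 − λ_1^{-2})·Σ_n = (|P_n|² + |Q_n|²)², where Σ_n := λ_1(U_n + U_{n-1}) conj(P_n)² + λ_1(U_n + U_{n-1}) conj(Q_n)², and both sides equal (λ_1² + λ_1^{-2} − 2)(U_n + U_{n-1})². -/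
open Complex ComplexConjugate

/-- If `P ^ 2`, `Q ^ 2` and `P * Q` are all real, then `(|P|² + |Q|²)² = (P² + Q²)²`. -/
theorem normSq_add_normSq_sq_eq {P Q : ℂ} {a b c : ℝ} (hP : P ^ 2 = (a : ℂ))
    (hQ : Q ^ 2 = (b : ℂ)) (hPQ : P * Q = (c : ℂ)) :
    (Complex.normSq P + Complex.normSq Q) ^ 2 = (a + b) ^ 2 := by
  have h₁ : Complex.normSq P ^ 2 = a ^ 2 := by
    rw [← map_pow, hP, Complex.normSq_ofReal, sq]
  have h₂ : Complex.normSq Q ^ 2 = b ^ 2 := by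
    rw [← map_pow, hQ, Complex.normSq_ofReal, sq]
  have h₃ : Complex.normSq P * Complex.normSq Q = c ^ 2 := by
    rw [← map_mul, hPQ, Complex.normSq_ofReal, sq]
  have h₄ : a * b = c ^ 2 := by
    have h : ((a * b : ℝ) : ℂ) = ((c ^ 2 : ℝ) : ℂ) := by
      push_cast
      rw [← hP, ← hQ, ← hPQ]
      ring
    exact_mod_cast h
  linear_combination h₁ + h₂ + 2 * h₃ - 2 * h₄

/-- dnoidal case of Lemma 6 of the paper. For a real standing wave
value pair `(Uₙ, Uₙ₋₁)`, a real band-edge eigenvalue `λ₁` with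
`ω = ½(λ₁²+λ₁⁻²) + σ₁√F₁`, and an eigenfunction pair `(Pₙ, Qₙ)` with
`Pₙ² = λ₁Uₙ − λ₁⁻¹Uₙ₋₁`, `Qₙ² = λ₁Uₙ₋₁ − λ₁⁻¹Uₙ`, `PₙQₙ = σ₁√F₁ − UₙUₙ₋₁`, one has
`(1 − λ₁⁻²)Σₙ = (|Pₙ|²+|Qₙ|²)²` with
`Σₙ = λ₁(Uₙ+Uₙ₋₁)conj(Pₙ)² + λ₁(Uₙ+Uₙ₋₁)conj(Qₙ)²`, and both sides equal
`(λ₁²+λ₁⁻²−2)(Uₙ+Uₙ₋₁)²`. -/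
theorem dnoidal_second_solution_key_identity
    (n : ℤ) (ω : ℝ) (Un Um : ℝ)
    (lam₁ : ℝ) (hlam₁ : lam₁ ≠ 0)
    (σ₁ : ℝ) (hσ₁ : σ₁ = 1 ∨ σ₁ = -1)
    (F₁ : ℝ) (hF₁nonneg : 0 ≤ F₁)
    (hF₁ : F₁ = 2 * ω * Un * Um - Un ^ 2 - Um ^ 2 - Un ^ 2 * Um ^ 2)
    (hω : ω = 1 / 2 * (lam₁ ^ 2 + lam₁⁻¹ ^ 2) + σ₁ * Real.sqrt F₁)
    (P Q : ℂ)
    (hP : P ^ 2 = ((lam₁ * Un - lam₁⁻¹ * Um : ℝ) : ℂ))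
    (hQ : Q ^ 2 = ((lam₁ * Um - lam₁⁻¹ * Un : ℝ) : ℂ))
    (hPQ : P * Q = ((σ₁ * Real.sqrt F₁ - Un * Um : ℝ) : ℂ)) :
    (1 - ((lam₁ : ℂ))⁻¹ ^ 2)
        * ((lam₁ : ℂ) * ((Un : ℂ) + (Um : ℂ)) * (conj P) ^ 2
          + (lam₁ : ℂ) * ((Un : ℂ) + (Um : ℂ)) * (conj Q) ^ 2)
      = ((Complex.normSq P + Complex.normSq Q : ℝ) : ℂ) ^ 2
    ∧ ((Complex.normSq P + Complex.normSq Q : ℝ) : ℂ) ^ 2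
      = ((lam₁ : ℂ) ^ 2 + ((lam₁ : ℂ))⁻¹ ^ 2 - 2) * ((Un : ℂ) + (Um : ℂ)) ^ 2 := by
  have hlam : (lam₁ : ℂ) ≠ 0 := by exact_mod_cast hlam₁
  have hnorm : ((Complex.normSq P + Complex.normSq Q : ℝ) : ℂ) ^ 2
      = ((lam₁ : ℂ) ^ 2 + ((lam₁ : ℂ))⁻¹ ^ 2 - 2) * ((Un : ℂ) + (Um : ℂ)) ^ 2 := by
    rw [← Complex.ofReal_pow, normSq_add_normSq_sq_eq hP hQ hPQ]
    push_cast
    field_simp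
    ring
  refine ⟨?_, hnorm⟩
  rw [hnorm, ← map_pow, ← map_pow, hP, hQ, Complex.conj_ofReal, Complex.conj_ofReal]
  push_cast
  field_simp
  ring
end

section
/- Fix n ∈ ℤ, let ω ∈ ℝ, let U_n, U_{n-1} ∈ ℂ with s := U_n conj(U_{n-1}) = conj(U_n) U_{n-1} ∈ ℝ (i.e. F_0 = 0), let F_1 < 0 satisfy F_1 = 2ωs − |U_n|² − |U_{n-1}|² − |U_n|²|U_{n-1}|², set r := i√(−F_1) (so r² = F_1), and let λ_1 ∈ ℂ\{0} satisfy ω = ½(λ_1² + λ_1^{-2}) + r. Let P_n, Q_n ∈ ℂ satisfy P_n² = λ_1 U_n − λ_1^{-1} U_{n-1}, Q_n² = λ_1 conj(U_{n-1}) − λ_1^{-1} conj(U_n), and P_n Q_n = r − s. Then (1 − |λ_1|^{-2})·Σ_n = (|P_n|² + |Q_n|²)², where Σ_n := (λ_1 U_n + conj(λ_1) U_{n-1}) conj(P_n)² + (conj(λ_1) conj(U_n) + λ_1 conj(U_{n-1})) conj(Q_n)² − (1 + |λ_1|^{-2})(λ_1² − conj(λ_1)²) conj(P_n) conj(Q_n).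 -/
open Complex ComplexConjugate

/-- cnoidal case of Lemma 6 of the paper. For a standing wave value
pair `(Uₙ, Uₙ₋₁)` with trivial phase (`Uₙ conj(Uₙ₋₁) = conj(Uₙ)Uₙ₋₁ = s ∈ ℝ`),
conserved quantity `F₁ < 0`, `r = i√(−F₁)`, a band-edge eigenvalue `λ₁` with
`ω = ½(λ₁²+λ₁⁻²) + r`, and an eigenfunction pair `(Pₙ, Qₙ)` with
`Pₙ² = λ₁Uₙ − λ₁⁻¹Uₙ₋₁`, `Qₙ² = λ₁conj(Uₙ₋₁) − λ₁⁻¹conj(Uₙ)`, `PₙQₙ = r − s`,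
one has `(1 − |λ₁|⁻²)Σₙ = (|Pₙ|²+|Qₙ|²)²` where
`Σₙ = (λ₁Uₙ + conj(λ₁)Uₙ₋₁)conj(Pₙ)² + (conj(λ₁)conj(Uₙ) + λ₁conj(Uₙ₋₁))conj(Qₙ)²
  − (1+|λ₁|⁻²)(λ₁² − conj(λ₁)²)conj(Pₙ)conj(Qₙ)`. -/
theorem cnoidal_second_solution_key_identity
    (n : ℤ) (ω : ℝ) (Un Um : ℂ) (s : ℝ)
    (hs₁ : Un * conj Um = (s : ℂ)) (hs₂ : conj Un * Um = (s : ℂ))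
    (F₁ : ℝ) (hF₁neg : F₁ < 0)
    (hF₁ : F₁ = 2 * ω * s - Complex.normSq Un - Complex.normSq Um
      - Complex.normSq Un * Complex.normSq Um)
    (r : ℂ) (hr : r = Complex.I * (Real.sqrt (-F₁) : ℂ))
    (lam₁ : ℂ) (hlam₁ : lam₁ ≠ 0)
    (hω : (ω : ℂ) = (1 / 2 : ℂ) * (lam₁ ^ 2 + lam₁⁻¹ ^ 2) + r)
    (P Q : ℂ)
    (hP : P ^ 2 = lam₁ * Un - lam₁⁻¹ * Um)
    (hQ : Q ^ 2 = lam₁ * conj Um - lam₁⁻¹ * conj Un)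
    (hPQ : P * Q = r - (s : ℂ)) :
    (1 - ((Complex.normSq lam₁ : ℂ))⁻¹)
        * ((lam₁ * Un + conj lam₁ * Um) * (conj P) ^ 2
          + (conj lam₁ * conj Un + lam₁ * conj Um) * (conj Q) ^ 2
          - (1 + ((Complex.normSq lam₁ : ℂ))⁻¹) * (lam₁ ^ 2 - (conj lam₁) ^ 2)
            * conj P * conj Q)
      = ((Complex.normSq P + Complex.normSq Q : ℝ) : ℂ) ^ 2 := by
  have hr2 : r ^ 2 = (F₁ : ℂ) := by
    rw [hr, mul_pow, Complex.I_sq, ← Complex.ofReal_pow, Real.sq_sqrt (by linarith)]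
    push_cast
    ring
  have hrc : conj r = -r := by
    rw [hr, map_mul, Complex.conj_I, Complex.conj_ofReal]
    ring
  have hF : (F₁ : ℂ) = 2 * ω * s - Un * conj Un - Um * conj Um
      - (Un * conj Un) * (Um * conj Um) := by
    rw [hF₁]
    push_cast [← Complex.mul_conj]
    ring
  have hPc := congrArg conj hP
  have hQc := congrArg conj hQ
  have hPQc := congrArg conj hPQ
  have hωc := congrArg conj hω
  have hm : conj lam₁ ≠ 0 := (map_ne_zero _).2 hlam₁
  simp only [map_pow, map_sub, map_add, map_mul, map_inv₀, map_div₀, map_one, map_ofNat,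
    Complex.conj_conj, Complex.conj_ofReal, hrc] at hPc hQc hPQc hωc
  push_cast [← Complex.mul_conj]
  have hl : lam₁ * lam₁⁻¹ = 1 := mul_inv_cancel₀ hlam₁
  have hmi : conj lam₁ * (conj lam₁)⁻¹ = 1 := mul_inv_cancel₀ hm
  rw [mul_inv]
  generalize conj lam₁ = m at *
  generalize conj P = p at *
  generalize conj Q = q at *
  generalize conj Un = a at *
  generalize conj Um = b at *
  generalize m⁻¹ = mi at *
  generalize lam₁⁻¹ = li at *
  have hω4 : (ω : ℂ) = (lam₁ ^ 2 + li ^ 2 + m ^ 2 + mi ^ 2) / 4 := by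
    linear_combination (hω + hωc) / 2
  have hr4 : r = -(lam₁ ^ 2 + li ^ 2 - m ^ 2 - mi ^ 2) / 4 := by
    linear_combination (hωc - hω) / 2
  have hR : (P * p + Q * q) ^ 2 = (lam₁ * m + li * mi - 2) * (Un * a + Um * b)
      - 2 * s * (lam₁ * mi + li * m) + 4 * ω * s - 4 * r ^ 2 := by
    have e : (P * p + Q * q) ^ 2 = P ^ 2 * p ^ 2 + Q ^ 2 * q ^ 2 + 2 * (P * Q) * (p * q) := by
      ring
    rw [e, hP, hPc, hQ, hQc, hPQ, hPQc]
    linear_combination (-2 * (lam₁ * mi)) * hs₁ - 2 * li * m * hs₂ + 2 * hF - 2 * s * hs₂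
      - 2 * a * Um * hs₁ + 2 * hr2
  have hS : (lam₁ * Un + m * Um) * p ^ 2 + (m * a + lam₁ * b) * q ^ 2
      - (1 + li * mi) * (lam₁ ^ 2 - m ^ 2) * p * q
      = (lam₁ * m - 1) * (Un * a + Um * b) + 2 * s * (m ^ 2 - lam₁ * mi)
        + (1 + li * mi) * (lam₁ ^ 2 - m ^ 2) * (r + s) := by
    rw [mul_assoc _ p q, hPc, hQc, hPQc]
    linear_combination (-2 * (lam₁ * mi)) * hs₁ + 2 * m ^ 2 * hs₂
      - (Un * a + Um * b) * hmi
  rw [hR, hS, hω4]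
  have h1 : (1 - li * mi) * (lam₁ * m - 1) = lam₁ * m + li * mi - 2 := by
    linear_combination -m * mi * hl - hmi
  have h2 : (1 - li * mi) * ((1 + li * mi) * (lam₁ ^ 2 - m ^ 2)) = -4 * r := by
    rw [hr4]
    linear_combination (-mi ^ 2 * (lam₁ * li + 1)) * hl + (li ^ 2 * (m * mi + 1)) * hmi
  have h3 : (1 - li * mi) * (m ^ 2 - lam₁ * mi) = m ^ 2 + mi ^ 2 - lam₁ * mi - li * m := by
    linear_combination mi ^ 2 * hl - li * m * hmi
  linear_combination (Un * a + Um * b) * h1 + (r + s) * h2 + 2 * s * h3 - 4 * s * hr4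
end

section
/- Let u : ℝ → (ℤ → ℂ) solve the Ablowitz–Ladik equation i u̇_n + (1+|u_n|²)(u_{n+1}+u_{n-1}) = 0, let λ_1 ∈ ℂ\{0}, and let (p_n(t), q_n(t)), n ∈ ℤ, be a solution of the Lax system φ_{n+1} = U(u_n,λ_1)φ_n, φ̇_n = V(u_n, u_{n-1}, λ_1)φ_n with (p_n(t), q_n(t)) ≠ (0,0) for all n, t. Then: (1) û_n := −(λ_1(|p_n|² + |λ_1|²|q_n|²))/(conj(λ_1)(|λ_1|²|p_n|² + |q_n|²))·u_n + (λ_1(1 − |λ_1|⁴) p_n conj(q_n))/(conj(λ_1)²(|λ_1|²|p_n|² + |q_n|²)) again solves the Ablowitz–Ladik equation; and (2) for every λ ∈ ℂ\{0} and every solution φ_n(t) of the Lax system with potential u and parameter λ, the function φ̂_n := M_n(λ)φ_n solves the Lax system with potential û and the same parameter λ, where M_n(λ) := √((|p_n|² + |λ_1|²|q_n|²)/(|λ_1|²|p_n|² + |q_n|²))·[[λ + λ^{-1}a_n, b_n],[−conj(b_n), λ conj(a_n) + λ^{-1}]], a_n := −(λ_1(|λ_1|²|p_n|² + |q_n|²))/(conj(λ_1)(|p_n|²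 + |λ_1|²|q_n|²)), b_n := (λ_1(1 − |λ_1|⁴) p_n conj(q_n))/(|λ_1|²(|p_n|² + |λ_1|²|q_n|²)). -/
open Complex ComplexConjugate

/-- `aₙ = −λ₁(|λ₁|²|pₙ|² + |qₙ|²) / (conj(λ₁)(|pₙ|² + |λ₁|²|qₙ|²))`. -/
noncomputable def DTa (lam₁ p q : ℂ) : ℂ :=
  -(lam₁ * ((Complex.normSq lam₁ * Complex.normSq p + Complex.normSq q : ℝ) : ℂ))
    / (conj lam₁ * ((Complex.normSq p + Complex.normSq lam₁ * Complex.normSq q : ℝ) : ℂ))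

/-- `bₙ = λ₁(1 − |λ₁|⁴) pₙ conj(qₙ) / (|λ₁|²(|pₙ|² + |λ₁|²|qₙ|²))`. -/
noncomputable def DTb (lam₁ p q : ℂ) : ℂ :=
  lam₁ * (1 - ((Complex.normSq lam₁ : ℝ) : ℂ) ^ 2) * p * conj q
    / (((Complex.normSq lam₁ : ℝ) : ℂ)
        * ((Complex.normSq p + Complex.normSq lam₁ * Complex.normSq q : ℝ) : ℂ))

/-- The scalar prefactor `√((|pₙ|² + |λ₁|²|qₙ|²)/(|λ₁|²|pₙ|² + |qₙ|²))` of the Darboux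
matrix `Mₙ(λ)`. -/
noncomputable def DTc (lam₁ p q : ℂ) : ℂ :=
  ((Real.sqrt ((Complex.normSq p + Complex.normSq lam₁ * Complex.normSq q)
      / (Complex.normSq lam₁ * Complex.normSq p + Complex.normSq q)) : ℝ) : ℂ)

/-- The Darboux-transformed potential
`ûₙ = −λ₁(|pₙ|²+|λ₁|²|qₙ|²)/(conj(λ₁)(|λ₁|²|pₙ|²+|qₙ|²)) uₙ
  + λ₁(1−|λ₁|⁴) pₙ conj(qₙ)/(conj(λ₁)²(|λ₁|²|pₙ|²+|qₙ|²))`. -/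
noncomputable def DThatU (lam₁ p q u : ℂ) : ℂ :=
  -(lam₁ * ((Complex.normSq p + Complex.normSq lam₁ * Complex.normSq q : ℝ) : ℂ))
      / (conj lam₁ * ((Complex.normSq lam₁ * Complex.normSq p + Complex.normSq q : ℝ) : ℂ))
      * u
    + lam₁ * (1 - ((Complex.normSq lam₁ : ℝ) : ℂ) ^ 2) * p * conj q
      / ((conj lam₁) ^ 2
          * ((Complex.normSq lam₁ * Complex.normSq p + Complex.normSq q : ℝ) : ℂ))

/-- First component of `φ̂ₙ = Mₙ(λ) φₙ` with `φₙ = (f, g)ᵀ`. -/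
noncomputable def DThatP (lam₁ lam p q f g : ℂ) : ℂ :=
  DTc lam₁ p q * ((lam + lam⁻¹ * DTa lam₁ p q) * f + DTb lam₁ p q * g)

/-- Second component of `φ̂ₙ = Mₙ(λ) φₙ` with `φₙ = (f, g)ᵀ`. -/
noncomputable def DThatQ (lam₁ lam p q f g : ℂ) : ℂ :=
  DTc lam₁ p q * (-conj (DTb lam₁ p q) * f + (lam * conj (DTa lam₁ p q) + lam⁻¹) * g)

/-- The rational identities behind the spatial half of the Darboux transformation, with the
conjugates `P, Q, L, U, …` treated as independent variables. -/
theorem darboux_space_identities {p P q Q l L u U : ℂ} (hl : l ≠ 0) (hL : L ≠ 0)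
    {D₁ D₂ : ℂ} (h₁ : D₁ = p * P + l * L * (q * Q)) (h₂ : D₂ = l * L * (p * P) + q * Q)
    (hD₁ : D₁ ≠ 0) (hD₂ : D₂ ≠ 0)
    {p' P' q' Q' : ℂ} (hp : p' = l * p + u * q) (hq : q' = -U * p + l⁻¹ * q)
    (hP : P' = L * P + U * Q) (hQ : Q' = -u * P + L⁻¹ * Q)
    {D₁' : ℂ} (h₁' : D₁' = p' * P' + l * L * (q' * Q')) (hD₁' : D₁' ≠ 0) {a a' b' B uh : ℂ}
    (ha : a = -(l * D₂) / (L * D₁))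
    (ha' : a' = -(l * (l * L * (p' * P') + q' * Q')) / (L * D₁'))
    (hb' : b' = (1 - (l * L) ^ 2) * p' * Q' / (L * D₁'))
    (hB : B = (1 - (l * L) ^ 2) * P * q / (l * D₁))
    (huh : uh = -(l * D₁) / (L * D₂) * u
      + l * (1 - (l * L) ^ 2) * p * Q / (L ^ 2 * D₂)) :
    uh = a' * u + b' ∧ a' - b' * U = a - uh * B := by
  have h₃ : D₁' = (1 + u * U) * D₂ := by
    rw [h₁', h₂, hp, hq, hP, hQ]
    field_simp
    ring
  have h₄ : 1 + u * U ≠ 0 := by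
    rintro h
    exact hD₁' (by rw [h₃, h, zero_mul])
  rw [h₃] at ha' hb'
  subst ha ha' hb' hB huh
  constructor
  · field_simp
    subst hp hq hP hQ h₁ h₂
    field_simp
    ring
  · field_simp
    subst hp hq hP hQ h₁ h₂
    field_simp
    ring

set_option maxHeartbeats 1000000 in
/-- The rational identities behind the temporal half of the Darboux transformation, with the
conjugates `P, Q, L, U, V, …` treated as independent variables. -/
theorem darboux_time_identities {p P q Q l L u U v V : ℂ} (hl : l ≠ 0) (hL : L ≠ 0)
    {D₁ D₂ : ℂ} (h₁ : D₁ = p * P + l * L * (q * Q)) (h₂ : D₂ = l * L * (p * P) + q * Q)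
    (hD₁ : D₁ ≠ 0) (hD₂ : D₂ ≠ 0)
    {a b A B uh Uh vh Vh W Wc pt qt Pt Qt D1t D2t w wh g : ℂ}
    (ha : a = -(l * D₂) / (L * D₁))
    (hA : A = -(L * D₂) / (l * D₁))
    (hb : b = (1 - (l * L) ^ 2) * p * Q / (L * D₁))
    (hB : B = (1 - (l * L) ^ 2) * P * q / (l * D₁))
    (huh : uh = -(l * D₁) / (L * D₂) * u
      + l * (1 - (l * L) ^ 2) * p * Q / (L ^ 2 * D₂))
    (hUh : Uh = -(L * D₁) / (l * D₂) * U
      + L * (1 - (l * L) ^ 2) * P * q / (l ^ 2 * D₂))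
    (hvh : vh = a * v + b) (hVh : Vh = A * V + B)
    (hW : W = 1 / 2 * (l ^ 2 + l⁻¹ ^ 2 + u * V + U * v))
    (hWc : Wc = 1 / 2 * (L ^ 2 + L⁻¹ ^ 2 + u * V + U * v))
    (hpt : pt = W * p + (l * u - l⁻¹ * v) * q)
    (hqt : qt = (-l * V + l⁻¹ * U) * p - W * q)
    (hPt : Pt = -(Wc * P + (L * U - L⁻¹ * V) * Q))
    (hQt : Qt = -((-L * v + L⁻¹ * u) * P - Wc * Q))
    (hD1 : D1t = pt * P + p * Pt + l * L * (qt * Q + q * Qt))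
    (hD2 : D2t = l * L * (pt * P + p * Pt) + (qt * Q + q * Qt))
    (hw : w = 1 / 2 * (u * V + U * v)) (hwh : wh = 1 / 2 * (uh * Vh + Uh * vh))
    (hg : g = 1 / 2 * (D1t / D₁ - D2t / D₂)) :
    g = wh - w + b * V - uh * B ∧ g * a = a * (w - wh) + b * U - vh * B ∧
    (1 - (l * L) ^ 2) * (pt * Q + p * Qt) / (L * D₁) -
      b * (D1t / D₁) + g * b
      = b * (w + wh) + uh - vh * A - a * u + v := by
  subst hg hwh hw hD2 hD1 hvh hVh huh hUh ha hA hb hB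
  refine ⟨?_, ?_, ?_⟩
  · field_simp
    subst hpt hqt hPt hQt hW hWc h₁ h₂
    field_simp
    ring
  · field_simp
    subst hpt hqt hPt hQt hW hWc h₁ h₂
    field_simp
    ring
  · field_simp
    subst hpt hqt hPt hQt hW hWc h₁ h₂
    field_simp
    ring

/-- `|p|² + |λ₁|²|q|²`. -/
noncomputable def DTnum (l p q : ℂ) : ℝ := normSq p + normSq l * normSq q

/-- `|λ₁|²|p|² + |q|²`. -/
noncomputable def DTden (l p q : ℂ) : ℝ := normSq l * normSq p + normSq q

theorem DTnum_pos {l p q : ℂ} (hl : l ≠ 0) (h : (p, q) ≠ (0, 0)) : 0 < DTnum l p q := by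
  have hl' := normSq_pos.2 hl
  have hp := normSq_nonneg p
  have hq := normSq_nonneg q
  unfold DTnum
  by_cases h0 : p = 0
  · have : q ≠ 0 := fun h1 => h (by rw [h0, h1])
    have := normSq_pos.2 this
    positivity
  · have := normSq_pos.2 h0
    positivity

theorem DTden_pos {l p q : ℂ} (hl : l ≠ 0) (h : (p, q) ≠ (0, 0)) : 0 < DTden l p q := by
  have h' : (q, p) ≠ (0, 0) := fun e => h (by simp_all)
  simpa [DTnum, DTden, add_comm] using DTnum_pos hl h'

theorem DTnum_cast (l p q : ℂ) :
    (DTnum l p q : ℂ) = p * conj p + l * conj l * (q * conj q) := by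
  simp [DTnum, mul_conj]

theorem DTden_cast (l p q : ℂ) :
    (DTden l p q : ℂ) = l * conj l * (p * conj p) + q * conj q := by
  simp [DTden, mul_conj]

theorem DTnum_smul (l p q : ℂ) (r : ℝ) :
    DTnum l (r * p) (r * q) = r ^ 2 * DTnum l p q := by
  simp only [DTnum, normSq_mul, normSq_ofReal]; ring

theorem DTden_smul (l p q : ℂ) (r : ℝ) :
    DTden l (r * p) (r * q) = r ^ 2 * DTden l p q := by
  simp only [DTden, normSq_mul, normSq_ofReal]; ring

theorem DTa_eq (l p q : ℂ) : DTa l p q = -(l * DTden l p q) / (conj l * DTnum l p q) := rfl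

theorem DTb_eq {l : ℂ} (hl : l ≠ 0) (p q : ℂ) :
    DTb l p q = (1 - (l * conj l) ^ 2) * p * conj q / (conj l * DTnum l p q) := by
  have hL : conj l ≠ 0 := by simpa using hl
  change l * (1 - ((normSq l : ℝ) : ℂ) ^ 2) * p * conj q
    / (((normSq l : ℝ) : ℂ) * (DTnum l p q : ℂ)) = _
  rw [← mul_conj, mul_assoc l (conj l), mul_assoc l, mul_assoc l, mul_div_mul_left _ _ hl]

theorem DTc_eq (l p q : ℂ) : DTc l p q = (√(DTnum l p q / DTden l p q) : ℝ) := rfl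

theorem DThatU_eq (l p q u : ℂ) :
    DThatU l p q u = -(l * DTnum l p q) / (conj l * DTden l p q) * u
      + l * (1 - (l * conj l) ^ 2) * p * conj q / (conj l ^ 2 * DTden l p q) := by
  rw [mul_conj]; rfl

theorem conj_DTa (l p q : ℂ) :
    conj (DTa l p q) = -(conj l * DTden l p q) / (l * DTnum l p q) := by
  simp [DTa_eq]

theorem conj_DTb {l : ℂ} (hl : l ≠ 0) (p q : ℂ) :
    conj (DTb l p q) = (1 - (l * conj l) ^ 2) * conj p * q / (l * DTnum l p q) := by
  simp [DTb_eq hl, mul_comm (conj l)]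
  rw [mul_comm l (DTnum l p q : ℂ)]

theorem conj_DThatU (l p q u : ℂ) :
    conj (DThatU l p q u) = -(conj l * DTnum l p q) / (l * DTden l p q) * conj u
      + conj l * (1 - (l * conj l) ^ 2) * conj p * q / (l ^ 2 * DTden l p q) := by
  simp [DThatU_eq, mul_comm (conj l) l]

theorem DTa_ne_zero {l p q : ℂ} (hl : l ≠ 0) (h : (p, q) ≠ (0, 0)) : DTa l p q ≠ 0 := by
  have h1 : (DTnum l p q : ℂ) ≠ 0 := ofReal_ne_zero.2 (DTnum_pos hl h).ne'
  have h2 : (DTden l p q : ℂ) ≠ 0 := ofReal_ne_zero.2 (DTden_pos hl h).ne'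
  have hL : conj l ≠ 0 := by simpa using hl
  rw [DTa_eq]
  exact div_ne_zero (neg_ne_zero.2 (mul_ne_zero hl h2)) (mul_ne_zero hL h1)

theorem DTa_smul (l p q : ℂ) {r : ℝ} (hr : r ≠ 0) : DTa l (r * p) (r * q) = DTa l p q := by
  have hr' : (r : ℂ) ^ 2 ≠ 0 := pow_ne_zero 2 (ofReal_ne_zero.2 hr)
  rw [DTa_eq, DTa_eq, DTnum_smul, DTden_smul]
  push_cast
  rw [mul_left_comm l, mul_left_comm (conj l), ← mul_neg, mul_div_mul_left _ _ hr']

theorem DTb_smul {l : ℂ} (hl : l ≠ 0) (p q : ℂ) {r : ℝ} (hr : r ≠ 0) :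
    DTb l (r * p) (r * q) = DTb l p q := by
  have hr' : (r : ℂ) ^ 2 ≠ 0 := pow_ne_zero 2 (ofReal_ne_zero.2 hr)
  rw [DTb_eq hl, DTb_eq hl, DTnum_smul, map_mul, conj_ofReal]
  push_cast
  rw [mul_left_comm (conj l), ← mul_div_mul_left _ (conj l * DTnum l p q) hr']
  congr 1
  ring

theorem DTc_smul (l p q : ℂ) {r : ℝ} (hr : r ≠ 0) : DTc l (r * p) (r * q) = DTc l p q := by
  rw [DTc_eq, DTc_eq, DTnum_smul, DTden_smul, mul_div_mul_left _ _ (pow_ne_zero 2 hr)]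

theorem DThatU_mul_conj_DTa {l p q : ℂ} (hl : l ≠ 0) (h : (p, q) ≠ (0, 0)) (u : ℂ) :
    u = DTb l p q + DThatU l p q u * conj (DTa l p q) := by
  have h1 : (DTnum l p q : ℂ) ≠ 0 := ofReal_ne_zero.2 (DTnum_pos hl h).ne'
  have h2 : (DTden l p q : ℂ) ≠ 0 := ofReal_ne_zero.2 (DTden_pos hl h).ne'
  have hL : conj l ≠ 0 := by simpa using hl
  rw [conj_DTa, DTb_eq hl, DThatU_eq]
  field_simp
  ring

theorem darboux_space {l : ℂ} (hl : l ≠ 0) {p q p' q' u : ℂ} (h : (p, q) ≠ (0, 0))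
    (h' : (p', q') ≠ (0, 0))
    (hp : p' = ((√(1 + normSq u) : ℝ) : ℂ)⁻¹ * (l * p + u * q))
    (hq : q' = ((√(1 + normSq u) : ℝ) : ℂ)⁻¹ * (-conj u * p + l⁻¹ * q)) :
    DThatU l p q u = DTa l p' q' * u + DTb l p' q' ∧
    DTa l p' q' - DTb l p' q' * conj u
      = DTa l p q - DThatU l p q u * conj (DTb l p q) := by
  have hr : (√(1 + normSq u))⁻¹ ≠ 0 :=
    inv_ne_zero (Real.sqrt_ne_zero'.2 (by linarith [normSq_nonneg u]))
  rw [← ofReal_inv] at hp hq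
  have h0 : (l * p + u * q, -conj u * p + l⁻¹ * q) ≠ (0, 0) := by
    intro e
    rw [Prod.mk.injEq] at e
    rw [e.1, mul_zero] at hp
    rw [e.2, mul_zero] at hq
    exact h' (by rw [hp, hq])
  rw [hp, hq, DTa_smul _ _ _ hr, DTb_smul hl _ _ hr]
  have hL : conj l ≠ 0 := by simpa using hl
  exact darboux_space_identities (p := p) (q := q) (P := conj p) (Q := conj q) (U := conj u) hl hL
    (DTnum_cast l p q) (DTden_cast l p q) (ofReal_ne_zero.2 (DTnum_pos hl h).ne')
    (ofReal_ne_zero.2 (DTden_pos hl h).ne') rfl rfl (by simp) (by simp)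
    (DTnum_cast l _ _) (ofReal_ne_zero.2 (DTnum_pos hl h0).ne') (DTa_eq l p q)
    (by rw [DTa_eq, DTden_cast]) (DTb_eq hl _ _) (conj_DTb hl p q) (DThatU_eq l p q u)

/-- Equality of determinants, a consequence of the spatial compatibility relations. -/
theorem darboux_det {a b a' b' u uh : ℂ} (h1 : u = b + uh * conj a) (h2 : uh = a' * u + b')
    (h3 : a' - b' * conj u = a - uh * conj b) :
    a' * (1 + u * conj u) = a * (1 + uh * conj uh) := by
  have h1' : conj u = conj b + conj uh * a := by
    have := congrArg conj h1
    simpa using this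
  linear_combination h3 + uh * h1' - conj u * h2

theorem DTc_mul_sqrt {l : ℂ} (hl : l ≠ 0) {p q p' q' u uh : ℂ} (h : (p, q) ≠ (0, 0))
    (h' : (p', q') ≠ (0, 0))
    (hd : DTa l p' q' * (1 + u * conj u) = DTa l p q * (1 + uh * conj uh)) :
    DTc l p' q' * ((√(1 + normSq u) : ℝ) : ℂ)⁻¹
      = DTc l p q * ((√(1 + normSq uh) : ℝ) : ℂ)⁻¹ := by
  have n1 := DTnum_pos hl h
  have n2 := DTden_pos hl h
  have n1' := DTnum_pos hl h'
  have n2' := DTden_pos hl h'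
  have s1 : 0 < 1 + normSq u := by linarith [normSq_nonneg u]
  have s2 : 0 < 1 + normSq uh := by linarith [normSq_nonneg uh]
  have key : DTden l p' q' / DTnum l p' q' * (1 + normSq u)
      = DTden l p q / DTnum l p q * (1 + normSq uh) := by
    have hL : conj l ≠ 0 := by simpa using hl
    rw [mul_conj, mul_conj, DTa_eq, DTa_eq] at hd
    rw [← ofReal_inj]
    push_cast
    have e : ∀ x y : ℂ, x / y = -(conj l / l) * (-(l * x) / (conj l * y)) := by
      intro x y
      field_simp
    rw [e, e (DTden l p q), mul_assoc, hd, mul_assoc]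
  rw [DTc_eq, DTc_eq, ← ofReal_inv, ← ofReal_inv, ← ofReal_mul, ← ofReal_mul, ofReal_inj,
    ← Real.sqrt_inv, ← Real.sqrt_inv, ← Real.sqrt_mul (by positivity),
    ← Real.sqrt_mul (by positivity)]
  congr 1
  field_simp at key ⊢
  linear_combination -key

theorem HasDerivAt.conj_comp {f : ℝ → ℂ} {f' : ℂ} {t : ℝ} (h : HasDerivAt f f' t) :
    HasDerivAt (fun s => conj (f s)) (conj f') t :=
  h.star

theorem HasDerivAt.conj_eq_of_ofReal {x : ℝ → ℝ} {z : ℂ} {t : ℝ}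
    (h : HasDerivAt (fun s => (x s : ℂ)) z t) : conj z = z := by
  have h' := h.conj_comp
  simp only [conj_ofReal] at h'
  exact h'.unique h

theorem HasDerivAt.ofReal_sqrt {x : ℝ → ℝ} {z : ℂ} {t : ℝ} (hx : 0 < x t)
    (h : HasDerivAt (fun s => (x s : ℂ)) (x t * (2 * z)) t) :
    HasDerivAt (fun s => ((√(x s) : ℝ) : ℂ)) ((√(x t) : ℝ) * z) t := by
  have h1 : HasDerivAt x ((x t : ℂ) * (2 * z)).re t := by
    exact (reCLM.hasFDerivAt (x := (x t : ℂ))).comp_hasDerivAt t h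
  have h2 := (h1.sqrt hx.ne').ofReal_comp
  have h3 : (((x t : ℂ) * (2 * z)).re : ℂ) = x t * (2 * z) :=
    conj_eq_iff_re.1 h.conj_eq_of_ofReal
  refine h2.congr_deriv ?_
  have h4 : ((√(x t) : ℝ) : ℂ) ≠ 0 := ofReal_ne_zero.2 (Real.sqrt_ne_zero'.2 hx)
  have h5 : (x t : ℂ) = (√(x t) : ℝ) * (√(x t) : ℝ) := by
    rw [← ofReal_mul, Real.mul_self_sqrt hx.le]
  push_cast
  rw [h3]
  field_simp
  rw [h5]
  ring

theorem darboux_time {l : ℂ} (hl : l ≠ 0) {p q : ℝ → ℂ} {t : ℝ} {u v uh vh : ℂ}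
    (h : ∀ s, (p s, q s) ≠ (0, 0))
    (hp : HasDerivAt p (I * (ALW u v l * p t + (l * u - l⁻¹ * v) * q t)) t)
    (hq : HasDerivAt q (I * ((-l * conj v + l⁻¹ * conj u) * p t - ALW u v l * q t)) t)
    (huh : uh = DThatU l (p t) (q t) u)
    (hvh : vh = DTa l (p t) (q t) * v + DTb l (p t) (q t)) :
    ∃ z β : ℂ, conj z = z ∧
      HasDerivAt (fun s => DTc l (p s) (q s)) (DTc l (p t) (q t) * z) t ∧
      HasDerivAt (fun s => DTa l (p s) (q s)) (-(2 * z * DTa l (p t) (q t))) t ∧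
      HasDerivAt (fun s => DTb l (p s) (q s)) β t ∧
      z = I * (1 / 2 * (uh * conj vh + conj uh * vh) - 1 / 2 * (u * conj v + conj u * v)
        + DTb l (p t) (q t) * conj v - uh * conj (DTb l (p t) (q t))) ∧
      z * DTa l (p t) (q t) = I * (DTa l (p t) (q t) * (1 / 2 * (u * conj v + conj u * v)
        - 1 / 2 * (uh * conj vh + conj uh * vh)) + DTb l (p t) (q t) * conj u
        - vh * conj (DTb l (p t) (q t))) ∧
      β + z * DTb l (p t) (q t) = I * (DTb l (p t) (q t) * (1 / 2 * (u * conj v + conj u * v)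
        + 1 / 2 * (uh * conj vh + conj uh * vh)) + uh - vh * conj (DTa l (p t) (q t))
        - DTa l (p t) (q t) * u + v) := by
  have hL : conj l ≠ 0 := by simpa using hl
  have n1 : ∀ s, (DTnum l (p s) (q s) : ℂ) ≠ 0 := fun s =>
    ofReal_ne_zero.2 (DTnum_pos hl (h s)).ne'
  have n2 : ∀ s, (DTden l (p s) (q s) : ℂ) ≠ 0 := fun s =>
    ofReal_ne_zero.2 (DTden_pos hl (h s)).ne'
  obtain ⟨pt, hpt⟩ : ∃ x, x = ALW u v l * p t + (l * u - l⁻¹ * v) * q t := ⟨_, rfl⟩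
  obtain ⟨qt, hqt⟩ : ∃ x, x = (-l * conj v + l⁻¹ * conj u) * p t - ALW u v l * q t := ⟨_, rfl⟩
  obtain ⟨D1t, hD1t⟩ : ∃ x, x = pt * conj (p t) + p t * -conj pt
    + l * conj l * (qt * conj (q t) + q t * -conj qt) := ⟨_, rfl⟩
  obtain ⟨D2t, hD2t⟩ : ∃ x, x = l * conj l * (pt * conj (p t) + p t * -conj pt)
    + (qt * conj (q t) + q t * -conj qt) := ⟨_, rfl⟩
  rw [← hpt] at hp
  rw [← hqt] at hq
  have hP := hp.conj_comp
  have hQ := hq.conj_comp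
  have hN : HasDerivAt (fun s => (DTnum l (p s) (q s) : ℂ)) (I * D1t) t := by
    simp only [DTnum_cast]
    refine HasDerivAt.congr_deriv ((hp.mul hP).add ((hq.mul hQ).const_mul (l * conj l))) ?_
    simp only [map_mul, conj_I]
    rw [hD1t]
    ring
  have hD : HasDerivAt (fun s => (DTden l (p s) (q s) : ℂ)) (I * D2t) t := by
    simp only [DTden_cast]
    refine HasDerivAt.congr_deriv (((hp.mul hP).const_mul (l * conj l)).add (hq.mul hQ)) ?_
    simp only [map_mul, conj_I]
    rw [hD2t]
    ring
  obtain ⟨g, hg⟩ : ∃ x, x = 1 / 2 * (D1t / DTnum l (p t) (q t) - D2t / DTden l (p t) (q t)) :=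
    ⟨_, rfl⟩
  have hX : HasDerivAt (fun s => ((DTnum l (p s) (q s) / DTden l (p s) (q s) : ℝ) : ℂ))
      ((DTnum l (p t) (q t) / DTden l (p t) (q t) : ℝ) * (2 * (I * g))) t := by
    simp only [ofReal_div]
    refine HasDerivAt.congr_deriv (hN.div hD (n2 t)) ?_
    rw [hg]
    have := n1 t
    have := n2 t
    field_simp
  have hXpos : 0 < DTnum l (p t) (q t) / DTden l (p t) (q t) :=
    div_pos (DTnum_pos hl (h t)) (DTden_pos hl (h t))
  have hz : conj (I * g) = I * g := by
    have := hX.conj_eq_of_ofReal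
    simp only [map_mul, conj_ofReal, map_ofNat] at this ⊢
    have e : (2 : ℂ) ≠ 0 := two_ne_zero
    exact mul_left_cancel₀ e (mul_left_cancel₀ (ofReal_ne_zero.2 hXpos.ne') this)
  have ids := darboux_time_identities (p := p t) (P := conj (p t)) (q := q t) (Q := conj (q t))
    (U := conj u) (V := conj v) (Uh := conj uh) (Vh := conj vh) (v := v) hl hL
    (DTnum_cast l (p t) (q t)) (DTden_cast l (p t) (q t)) (n1 t) (n2 t)
    (DTa_eq l (p t) (q t)) (conj_DTa l (p t) (q t)) (DTb_eq hl (p t) (q t))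
    (conj_DTb hl (p t) (q t)) (huh.trans (DThatU_eq l (p t) (q t) u))
    ((congrArg conj huh).trans (conj_DThatU l (p t) (q t) u)) hvh
    (by rw [hvh]; simp) (W := ALW u v l) (Wc := conj (ALW u v l)) rfl
    (by
      simp only [ALW, map_mul, map_add, map_div₀, map_one, map_ofNat, map_pow, map_inv₀, conj_conj]
      ring) hpt hqt (Pt := -conj pt) (Qt := -conj qt)
    (by rw [hpt]; simp) (by rw [hqt]; simp) hD1t hD2t rfl rfl hg
  obtain ⟨i1, i2, i3⟩ := ids
  refine ⟨I * g, I * ((1 - (l * conj l) ^ 2) * (pt * conj (q t) + p t * -conj qt)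
      / (conj l * DTnum l (p t) (q t))
      - DTb l (p t) (q t) * (D1t / DTnum l (p t) (q t))),
    hz, hX.ofReal_sqrt hXpos, ?_, ?_, ?_, ?_, ?_⟩
  · simp only [DTa_eq]
    refine HasDerivAt.congr_deriv (((hD.const_mul l).fun_neg).div (hN.const_mul (conj l)) (mul_ne_zero hL (n1 t))) ?_
    rw [hg]
    have := n1 t
    have := n2 t
    field_simp
    ring
  · simp only [DTb_eq hl]
    refine (((hp.const_mul (1 - (l * conj l) ^ 2)).fun_mul hQ).div (hN.const_mul (conj l))
      (mul_ne_zero hL (n1 t))).congr_deriv ?_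
    simp only [map_mul, conj_I]
    have := n1 t
    field_simp
  · rw [← i1]
  · rw [← i2]; ring
  · rw [← i3]; ring

/-- The algebra showing that the transformed potential solves the Ablowitz–Ladik equation, with
conjugates treated as independent variables. Here `v = u_{n-1}` and `s = u_{n+1}`. -/
theorem darboux_AL_identity {a A b B a' A' b' u U v V s uh Uh vh Vh sh z β du : ℂ} (hA : A ≠ 0)
    (h1 : u = b + uh * A) (h1c : U = B + Uh * a) (h2 : vh = a * v + b) (h2c : Vh = A * V + B)
    (h3 : uh = a' * u + b') (h4 : s = b' + sh * A')
    (hd : a' * (1 + u * U) = a * (1 + uh * Uh)) (hdc : A' * (1 + u * U) = A * (1 + uh * Uh))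
    (hz : z = I * (1 / 2 * (uh * Vh + Uh * vh) - 1 / 2 * (u * V + U * v) + b * V - uh * B))
    (hzA : z * A = -I * (A * (1 / 2 * (u * V + U * v) - 1 / 2 * (uh * Vh + Uh * vh)) + B * u
      - Vh * b))
    (hβ : β + z * b = I * (b * (1 / 2 * (u * V + U * v) + 1 / 2 * (uh * Vh + Uh * vh)) + uh
      - vh * A - a * u + v))
    (hu : I * du + (1 + u * U) * (s + v) = 0) :
    I * ((du - β + uh * (2 * z * A)) / A) + (1 + uh * Uh) * (sh + vh) = 0 := by
  have e1 : I * β + I * z * b = -(b * (1 / 2 * (u * V + U * v) + 1 / 2 * (uh * Vh + Uh * vh)) + uh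
      - vh * A - a * u + v) := by
    linear_combination I * hβ + (b * (1 / 2 * (u * V + U * v) + 1 / 2 * (uh * Vh + Uh * vh)) + uh
      - vh * A - a * u + v) * I_sq
  have e2 : I * z = -(1 / 2 * (uh * Vh + Uh * vh) - 1 / 2 * (u * V + U * v) + b * V - uh * B) := by
    linear_combination I * hz + (1 / 2 * (uh * Vh + Uh * vh) - 1 / 2 * (u * V + U * v)
      + b * V - uh * B) * I_sq
  have e3 : I * z * A = A * (1 / 2 * (u * V + U * v) - 1 / 2 * (uh * Vh + Uh * vh)) + B * u
      - Vh * b := by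
    linear_combination I * hzA - (A * (1 / 2 * (u * V + U * v) - 1 / 2 * (uh * Vh + Uh * vh))
      + B * u - Vh * b) * I_sq
  have e4 : A * (1 + uh * Uh) * sh = (1 + u * U) * (s - uh) + a * (1 + uh * Uh) * u := by
    linear_combination -sh * hdc - (1 + u * U) * h4 + (1 + u * U) * h3 + u * hd
  have e5 : -(1 + u * U) * (s + v)
      + (b * (1 / 2 * (u * V + U * v) + 1 / 2 * (uh * Vh + Uh * vh)) + uh - vh * A - a * u + v)
      - (1 / 2 * (uh * Vh + Uh * vh) - 1 / 2 * (u * V + U * v) + b * V - uh * B) * u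
      + (A * (1 / 2 * (u * V + U * v) - 1 / 2 * (uh * Vh + Uh * vh)) + B * u - Vh * b) * uh
      + ((1 + u * U) * (s - uh) + a * (1 + uh * Uh) * u) + A * (1 + uh * Uh) * vh = 0 := by
    clear e1 e2 e3 e4 hz hzA hβ hu hd hdc h3 h4
    subst h1 h1c h2 h2c
    ring
  field_simp
  linear_combination e5 + hu - e1 + u * e2 + uh * e3 + e4 - I * z * h1

/-- The transformed potential at `n - 1` in terms of the eigenfunction at `n`. -/
theorem DThatU_sub_one {u : ℝ → ℤ → ℂ} {l : ℂ} (hl : l ≠ 0) {p q : ℤ → ℝ → ℂ}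
    (hpq : ∀ (n : ℤ) (t : ℝ),
      p (n + 1) t = ((√(1 + normSq (u t n)) : ℂ))⁻¹ * (l * p n t + u t n * q n t)
      ∧ q (n + 1) t = ((√(1 + normSq (u t n)) : ℂ))⁻¹ * (-conj (u t n) * p n t + l⁻¹ * q n t))
    (hnz : ∀ (n : ℤ) (t : ℝ), (p n t, q n t) ≠ (0, 0)) (n : ℤ) (t : ℝ) :
    DThatU l (p (n - 1) t) (q (n - 1) t) (u t (n - 1))
      = DTa l (p n t) (q n t) * u t (n - 1) + DTb l (p n t) (q n t) := by
  have h := hpq (n - 1) t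
  rw [sub_add_cancel] at h
  exact (darboux_space hl (hnz _ _) (hnz _ _) h.1 h.2).1

theorem darboux_space_fst {x m c c' r R a b B A a' b' u U uh f g : ℂ} (hm : x * m = 1)
    (hc : c' * r = c * R) (h1 : u = b + uh * A) (h2 : uh = a' * u + b')
    (h3 : a' - b' * U = a - uh * B) :
    c' * ((x + m * a') * (r * (x * f + u * g)) + b' * (r * (-U * f + m * g)))
      = R * (x * (c * ((x + m * a) * f + b * g)) + uh * (c * (-B * f + (x * A + m) * g))) := by
  linear_combination ((x + m * a') * (x * f + u * g) + b' * (-U * f + m * g)) * hc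
    + c * R * (f * h3 + f * (a' - a) * hm + x * g * h1 - m * g * h2)

theorem darboux_space_snd {x m c c' r R a b B A A' B' u U Uh f g : ℂ} (hm : x * m = 1)
    (hc : c' * r = c * R) (h1 : U = B + Uh * a) (h2 : Uh = A' * U + B')
    (h3 : A' - B' * u = A - Uh * b) :
    c' * (-B' * (r * (x * f + u * g)) + (x * A' + m) * (r * (-U * f + m * g)))
      = R * (-Uh * (c * ((x + m * a) * f + b * g)) + m * (c * (-B * f + (x * A + m) * g))) := by
  linear_combination (-B' * (x * f + u * g) + (x * A' + m) * (-U * f + m * g)) * hc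
    + c * R * (g * h3 + g * (A' - A) * hm + x * f * h2 - m * f * h1)

theorem darboux_time_fst {x c a b z β u v uh vh f g : ℂ} (hm : x * x⁻¹ = 1)
    (h1 : u = b + uh * conj a) (h2 : vh = a * v + b)
    (hz : z = I * (1 / 2 * (uh * conj vh + conj uh * vh) - 1 / 2 * (u * conj v + conj u * v)
      + b * conj v - uh * conj b))
    (hza : z * a = I * (a * (1 / 2 * (u * conj v + conj u * v)
      - 1 / 2 * (uh * conj vh + conj uh * vh)) + b * conj u - vh * conj b))
    (hβ : β + z * b = I * (b * (1 / 2 * (u * conj v + conj u * v)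
      + 1 / 2 * (uh * conj vh + conj uh * vh)) + uh - vh * conj a - a * u + v)) :
    c * z * ((x + x⁻¹ * a) * f + b * g)
      + c * (x⁻¹ * -(2 * z * a) * f + (x + x⁻¹ * a) * (I * (ALW u v x * f + (x * u - x⁻¹ * v) * g))
        + (β * g + b * (I * ((-x * conj v + x⁻¹ * conj u) * f - ALW u v x * g))))
      = I * (ALW uh vh x * (c * ((x + x⁻¹ * a) * f + b * g))
        + (x * uh - x⁻¹ * vh) * (c * (-conj b * f + (x * conj a + x⁻¹) * g))) := by
  unfold ALW
  linear_combination c * (x * f * hz - x⁻¹ * f * hza + g * hβ)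
    + I * c * g * (x ^ 2 * h1 + x⁻¹ ^ 2 * h2 + (a * u - v - uh + vh * conj a) * hm)

theorem darboux_time_snd {x c a b z β u v uh vh f g : ℂ} (hm : x * x⁻¹ = 1)
    (h1 : conj u = conj b + conj uh * a) (h2 : conj vh = conj a * conj v + conj b)
    (hz : z = -I * (1 / 2 * (conj uh * vh + uh * conj vh) - 1 / 2 * (conj u * v + u * conj v)
      + conj b * v - conj uh * b))
    (hza : z * conj a = -I * (conj a * (1 / 2 * (conj u * v + u * conj v)
      - 1 / 2 * (conj uh * vh + uh * conj vh)) + conj b * u - conj vh * b))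
    (hβ : conj β + z * conj b = -I * (conj b * (1 / 2 * (conj u * v + u * conj v)
      + 1 / 2 * (conj uh * vh + uh * conj vh)) + conj uh - conj vh * a - conj a * conj u
      + conj v)) :
    c * z * (-conj b * f + (x * conj a + x⁻¹) * g)
      + c * (-conj β * f + -conj b * (I * (ALW u v x * f + (x * u - x⁻¹ * v) * g))
        + (x * -(2 * z * conj a) * g
          + (x * conj a + x⁻¹) * (I * ((-x * conj v + x⁻¹ * conj u) * f - ALW u v x * g))))
      = I * ((-x * conj vh + x⁻¹ * conj uh) * (c * ((x + x⁻¹ * a) * f + b * g))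
        - ALW uh vh x * (c * (-conj b * f + (x * conj a + x⁻¹) * g))) := by
  unfold ALW
  linear_combination c * (x⁻¹ * g * hz - x * g * hza - f * hβ)
    + I * c * f * (x ^ 2 * h2 + x⁻¹ ^ 2 * h1
      + (conj a * conj u - conj v + conj vh * a - conj uh) * hm)

/-- one-fold Darboux transformation, Lemma 7 of the paper. If `u`
solves the Ablowitz–Ladik equation and `(pₙ, qₙ)` is a nowhere-vanishing solution of
the non-standard Lax system with `λ = λ₁`, then the Darboux-transformed potential `û`
solves the Ablowitz–Ladik equation, and for every `λ ≠ 0` and every solution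
`φₙ = (fₙ, gₙ)ᵀ` of the Lax system with potential `u` and parameter `λ`, the function
`φ̂ₙ = Mₙ(λ)φₙ` solves the Lax system with potential `û` and parameter `λ`. -/
theorem one_fold_Darboux_transformation
    (u u' : ℝ → ℤ → ℂ)
    (hu : ∀ (n : ℤ) (t : ℝ), HasDerivAt (fun s => u s n) (u' t n) t)
    (hAL : ∀ (n : ℤ) (t : ℝ),
      Complex.I * u' t n
        + (1 + (Complex.normSq (u t n) : ℂ)) * (u t (n + 1) + u t (n - 1)) = 0)
    (lam₁ : ℂ) (hlam₁ : lam₁ ≠ 0)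
    (p q : ℤ → ℝ → ℂ)
    (hpq_space : ∀ (n : ℤ) (t : ℝ),
      p (n + 1) t = ((Real.sqrt (1 + Complex.normSq (u t n)) : ℂ))⁻¹
          * (lam₁ * p n t + u t n * q n t)
      ∧ q (n + 1) t = ((Real.sqrt (1 + Complex.normSq (u t n)) : ℂ))⁻¹
          * (-conj (u t n) * p n t + lam₁⁻¹ * q n t))
    (hpq_time : ∀ (n : ℤ) (t : ℝ),
      HasDerivAt (fun s => p n s)
        (Complex.I * (ALW (u t n) (u t (n - 1)) lam₁ * p n t
          + (lam₁ * u t n - lam₁⁻¹ * u t (n - 1)) * q n t)) t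
      ∧ HasDerivAt (fun s => q n s)
        (Complex.I * ((-lam₁ * conj (u t (n - 1)) + lam₁⁻¹ * conj (u t n)) * p n t
          - ALW (u t n) (u t (n - 1)) lam₁ * q n t)) t)
    (hnz : ∀ (n : ℤ) (t : ℝ), (p n t, q n t) ≠ (0, 0))
    (uh : ℝ → ℤ → ℂ)
    (huh : ∀ (t : ℝ) (n : ℤ), uh t n = DThatU lam₁ (p n t) (q n t) (u t n)) :
    (∀ (n : ℤ) (t : ℝ), ∃ d : ℂ,
      HasDerivAt (fun s => uh s n) d t
      ∧ Complex.I * d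
          + (1 + (Complex.normSq (uh t n) : ℂ)) * (uh t (n + 1) + uh t (n - 1)) = 0)
    ∧ (∀ lam : ℂ, lam ≠ 0 → ∀ f g : ℤ → ℝ → ℂ,
        (∀ (n : ℤ) (t : ℝ),
          f (n + 1) t = ((Real.sqrt (1 + Complex.normSq (u t n)) : ℂ))⁻¹
              * (lam * f n t + u t n * g n t)
          ∧ g (n + 1) t = ((Real.sqrt (1 + Complex.normSq (u t n)) : ℂ))⁻¹
              * (-conj (u t n) * f n t + lam⁻¹ * g n t)) →
        (∀ (n : ℤ) (t : ℝ),
          HasDerivAt (fun s => f n s)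
            (Complex.I * (ALW (u t n) (u t (n - 1)) lam * f n t
              + (lam * u t n - lam⁻¹ * u t (n - 1)) * g n t)) t
          ∧ HasDerivAt (fun s => g n s)
            (Complex.I * ((-lam * conj (u t (n - 1)) + lam⁻¹ * conj (u t n)) * f n t
              - ALW (u t n) (u t (n - 1)) lam * g n t)) t) →
        ∀ (n : ℤ) (t : ℝ),
          (DThatP lam₁ lam (p (n + 1) t) (q (n + 1) t) (f (n + 1) t) (g (n + 1) t)
              = ((Real.sqrt (1 + Complex.normSq (uh t n)) : ℂ))⁻¹
                * (lam * DThatP lam₁ lam (p n t) (q n t) (f n t) (g n t)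
                  + uh t n * DThatQ lam₁ lam (p n t) (q n t) (f n t) (g n t))
            ∧ DThatQ lam₁ lam (p (n + 1) t) (q (n + 1) t) (f (n + 1) t) (g (n + 1) t)
              = ((Real.sqrt (1 + Complex.normSq (uh t n)) : ℂ))⁻¹
                * (-conj (uh t n) * DThatP lam₁ lam (p n t) (q n t) (f n t) (g n t)
                  + lam⁻¹ * DThatQ lam₁ lam (p n t) (q n t) (f n t) (g n t)))
          ∧ HasDerivAt (fun s => DThatP lam₁ lam (p n s) (q n s) (f n s) (g n s))
              (Complex.I * (ALW (uh t n) (uh t (n - 1)) lam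
                  * DThatP lam₁ lam (p n t) (q n t) (f n t) (g n t)
                + (lam * uh t n - lam⁻¹ * uh t (n - 1))
                  * DThatQ lam₁ lam (p n t) (q n t) (f n t) (g n t))) t
          ∧ HasDerivAt (fun s => DThatQ lam₁ lam (p n s) (q n s) (f n s) (g n s))
              (Complex.I * ((-lam * conj (uh t (n - 1)) + lam⁻¹ * conj (uh t n))
                  * DThatP lam₁ lam (p n t) (q n t) (f n t) (g n t)
                - ALW (uh t n) (uh t (n - 1)) lam
                  * DThatQ lam₁ lam (p n t) (q n t) (f n t) (g n t))) t) := by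
  obtain rfl : uh = fun t n => DThatU lam₁ (p n t) (q n t) (u t n) := by
    funext t n
    exact huh t n
  clear huh
  have time (n : ℤ) (t : ℝ) := darboux_time hlam₁ (hnz n) (hpq_time n t).1 (hpq_time n t).2 rfl
    (DThatU_sub_one hlam₁ hpq_space hnz n t)
  have space (n : ℤ) (t : ℝ) := darboux_space hlam₁ (hnz n t) (hnz (n + 1) t)
    (hpq_space n t).1 (hpq_space n t).2
  have inv (n : ℤ) (t : ℝ) := DThatU_mul_conj_DTa hlam₁ (hnz n t) (u t n)
  have det (n : ℤ) (t : ℝ) := darboux_det (inv n t) (space n t).1 (space n t).2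
  refine ⟨fun n t => ?_, fun lam hlam f g hfg hfg' n t => ⟨?_, ?_⟩⟩
  · obtain ⟨z, β, hz, -, ha, hb, hz1, hz2, hβ⟩ := time n t
    have hA (s : ℝ) : conj (DTa lam₁ (p n s) (q n s)) ≠ 0 := by
      simpa using DTa_ne_zero hlam₁ (hnz n s)
    refine ⟨(u' t n - β + DThatU lam₁ (p n t) (q n t) (u t n)
      * (2 * z * conj (DTa lam₁ (p n t) (q n t)))) / conj (DTa lam₁ (p n t) (q n t)), ?_, ?_⟩
    · have e : (fun s => DThatU lam₁ (p n s) (q n s) (u s n)) = fun s =>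
          (u s n - DTb lam₁ (p n s) (q n s)) / conj (DTa lam₁ (p n s) (q n s)) := by
        funext s
        rw [eq_div_iff (hA s), eq_sub_iff_add_eq']
        exact (inv n s).symm
      rw [e]
      refine (((hu n t).fun_sub hb).fun_div ha.conj_comp (hA t)).congr_deriv ?_
      have hA := hA t
      simp only [map_neg, map_mul, hz, map_ofNat]
      rw [show u t n - DTb lam₁ (p n t) (q n t) = _ from sub_eq_iff_eq_add'.2 (inv n t)]
      field_simp
      ring
    · have hzA := congrArg conj hz2
      have hdc := congrArg conj (det n t)
      have h1c := congrArg conj (inv n t)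
      have h2c := congrArg conj (DThatU_sub_one hlam₁ hpq_space hnz n t)
      have hAL' := hAL n t
      simp only [map_mul, map_add, map_sub, hz, map_ofNat, map_one, conj_conj, conj_I,
        map_div₀] at hzA hdc h1c h2c
      rw [← mul_conj] at hAL' ⊢
      refine darboux_AL_identity (hA t) (inv n t) h1c (DThatU_sub_one hlam₁ hpq_space hnz n t)
        h2c (space n t).1 (inv (n + 1) t) (det n t) ?_ hz1 ?_ hβ hAL'
      · linear_combination hdc
      · linear_combination hzA
  · have hc := DTc_mul_sqrt hlam₁ (hnz n t) (hnz (n + 1) t) (det n t)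
    obtain ⟨s1, s2⟩ := space n t
    have s1c := congrArg conj s1
    have s2c := congrArg conj s2
    have h1c := congrArg conj (inv n t)
    simp only [map_mul, map_add, map_sub, conj_conj] at s1c s2c h1c
    have hm := mul_inv_cancel₀ hlam
    simp only [DThatP, DThatQ, (hfg n t).1, (hfg n t).2]
    exact ⟨darboux_space_fst hm hc (inv n t) s1 s2, darboux_space_snd hm hc h1c s1c s2c⟩
  · obtain ⟨z, β, hz, hc, ha, hb, hz1, hz2, hβ⟩ := time n t
    have h2 := DThatU_sub_one hlam₁ hpq_space hnz n t
    have hm := mul_inv_cancel₀ hlam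
    have hz1c := congrArg conj hz1
    have hz2c := congrArg conj hz2
    have hβc := congrArg conj hβ
    have h1c := congrArg conj (inv n t)
    have h2c := congrArg conj h2
    simp only [map_mul, map_add, map_sub, conj_conj, hz, conj_I, map_div₀, map_one, map_ofNat]
      at hz1c hz2c hβc h1c h2c
    obtain ⟨hf, hg⟩ := hfg' n t
    constructor
    · refine (hc.fun_mul ((((ha.const_mul lam⁻¹).const_add lam).fun_mul hf).fun_add
        (hb.fun_mul hg))).congr_deriv ?_
      exact darboux_time_fst hm (inv n t) h2 hz1 hz2 hβ
    · refine (hc.fun_mul ((hb.conj_comp.fun_neg.fun_mul hf).fun_add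
        (((ha.conj_comp.const_mul lam).add_const lam⁻¹).fun_mul hg))).congr_deriv ?_
      simp only [map_neg, map_mul, hz, map_ofNat]
      exact darboux_time_snd hm h1c h2c hz1c hz2c hβc
end

section
/- Let λ_1 ∈ ℝ\{0} with λ_1⁴ ≠ 1, let U_n, U_{n-1} ∈ ℝ with U_n ≠ 0, let σ_1 ∈ {+1, −1} and F_1 ≥ 0, and let P_n, Q_n ∈ ℂ\{0} satisfy P_n² = λ_1 U_n − λ_1^{-1} U_{n-1}, Q_n² = λ_1 U_{n-1} − λ_1^{-1} U_n, and P_n Q_n = σ_1 √F_1 − U_n U_{n-1}, with P_n Q_n ≠ 0. Then, provided λ_1²|P_n|² + |Q_n|² ≠ 0, the Darboux-transformed profile satisfies −((|P_n|² + λ_1²|Q_n|²)/(λ_1²|P_n|² + |Q_n|²))·U_n − ((λ_1³ − λ_1^{-1}) P_n conj(Q_n))/(λ_1²|P_n|² + |Q_n|²) = −σ_1 √F_1 / U_n. -/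
open Complex ComplexConjugate

/-- If `z ^ 2` and `z * w` are real and `z ≠ 0`, then conjugation multiplies `z` and `w` by the
same factor. -/
theorem exists_conj_eq_mul {z w : ℂ} {a b : ℝ} (hz : z ≠ 0) (hsq : z ^ 2 = a)
    (hmul : z * w = b) : ∃ ε : ℂ, conj z = ε * z ∧ conj w = ε * w := by
  have hsq' : conj z ^ 2 = z ^ 2 := by rw [← map_pow, hsq, conj_ofReal]
  have hmul' : conj z * conj w = z * w := by rw [← map_mul, hmul, conj_ofReal]
  refine ⟨conj z / z, (div_mul_cancel₀ _ hz).symm, ?_⟩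
  rw [div_mul_eq_mul_div, eq_div_iff hz]
  apply mul_left_cancel₀ ((map_ne_zero (starRingEnd ℂ)).mpr hz)
  linear_combination z * hmul' - w * hsq'

/-- Remark 8 of the paper. For a real standing wave value pair
`(Uₙ, Uₙ₋₁)`, a real band-edge eigenvalue `λ₁` and the periodic band-edge
eigenfunction `(Pₙ, Qₙ)` with `Pₙ² = λ₁Uₙ − λ₁⁻¹Uₙ₋₁`, `Qₙ² = λ₁Uₙ₋₁ − λ₁⁻¹Uₙ`,
`PₙQₙ = σ₁√F₁ − UₙUₙ₋₁`, the one-fold Darboux transformation produces the profile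
`Ûₙ = −σ₁√F₁/Uₙ`:
`−(|Pₙ|²+λ₁²|Qₙ|²)/(λ₁²|Pₙ|²+|Qₙ|²) Uₙ − (λ₁³−λ₁⁻¹)Pₙconj(Qₙ)/(λ₁²|Pₙ|²+|Qₙ|²)
  = −σ₁√F₁/Uₙ`. -/
theorem Darboux_dnoidal_profile
    (lam₁ : ℝ) (hlam₁ : lam₁ ≠ 0) (hlam₁' : lam₁ ^ 4 ≠ 1)
    (Un Um : ℝ) (hUn : Un ≠ 0)
    (σ₁ : ℝ) (hσ₁ : σ₁ = 1 ∨ σ₁ = -1)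
    (F₁ : ℝ) (hF₁nonneg : 0 ≤ F₁)
    (P Q : ℂ) (hPne : P ≠ 0) (hQne : Q ≠ 0)
    (hP : P ^ 2 = ((lam₁ * Un - lam₁⁻¹ * Um : ℝ) : ℂ))
    (hQ : Q ^ 2 = ((lam₁ * Um - lam₁⁻¹ * Un : ℝ) : ℂ))
    (hPQ : P * Q = ((σ₁ * Real.sqrt F₁ - Un * Um : ℝ) : ℂ))
    (hPQne : P * Q ≠ 0)
    (hden : ((lam₁ ^ 2 * Complex.normSq P + Complex.normSq Q : ℝ) : ℂ) ≠ 0) :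
    -(((Complex.normSq P + lam₁ ^ 2 * Complex.normSq Q : ℝ) : ℂ)
          / ((lam₁ ^ 2 * Complex.normSq P + Complex.normSq Q : ℝ) : ℂ)) * (Un : ℂ)
      - ((lam₁ ^ 3 - lam₁⁻¹ : ℝ) : ℂ) * P * conj Q
          / ((lam₁ ^ 2 * Complex.normSq P + Complex.normSq Q : ℝ) : ℂ)
    = -((σ₁ * Real.sqrt F₁ : ℝ) : ℂ) / (Un : ℂ) := by
  obtain ⟨ε, hcP, hcQ⟩ := exists_conj_eq_mul hPne hP hPQ
  have hnP : (Complex.normSq P : ℂ) = ε * P ^ 2 := by rw [← mul_conj, hcP]; ring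
  have hnQ : (Complex.normSq Q : ℂ) = ε * Q ^ 2 := by rw [← mul_conj, hcQ]; ring
  have hl : (lam₁ : ℂ) * (lam₁ : ℂ)⁻¹ = 1 := mul_inv_cancel₀ (by exact_mod_cast hlam₁)
  have hU : (Un : ℂ) ≠ 0 := by exact_mod_cast hUn
  push_cast at hP hQ hPQ hden ⊢
  rw [hnP, hnQ] at hden ⊢
  rw [hcQ]
  have hD : (lam₁ : ℂ) ^ 2 * (ε * P ^ 2) + ε * Q ^ 2 = ε * (lam₁ ^ 3 - (lam₁ : ℂ)⁻¹) * Un := by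
    rw [hP, hQ]
    linear_combination (-ε * lam₁ * Um) * hl
  have hN : ε * P ^ 2 + (lam₁ : ℂ) ^ 2 * (ε * Q ^ 2) = ε * (lam₁ ^ 3 - (lam₁ : ℂ)⁻¹) * Um := by
    rw [hP, hQ]
    linear_combination (-ε * lam₁ * Un) * hl
  rw [hD] at hden ⊢
  rw [hN, neg_mul, div_mul_eq_mul_div, ← neg_div, ← sub_div, div_eq_div_iff hden hU]
  linear_combination (-(lam₁ ^ 3 - (lam₁ : ℂ)⁻¹) * ε * Un) * hPQ
end
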